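/- arXiv:2109.07952 — 2 statements merged into one kernel-verified Lean document; each statement's English description precedes it below -/
import Mathlib

section
/- (Frequency-localized Bernstein inequality on the torus, case s = 2) Let d ≥ 1 and 1 < p < ∞. There exists a constant c > 0 depending only on (p, d) with the following property: for every integer N ≥ 2 and every smooth ℤ^d-periodic function f : ℝ^d → ℝ whose Fourier coefficients satisfy ĉ_k(f) = 0 whenever |k| < N or |k| > 2N, one has ∫_{[0,1]^d} (−Δf) |f|^{p−2} f dx ≥ c N² ∫_{[0,1]^d} |f|^p dx. -/
open MeasureTheory

/-- The unit cube `[0,1]^d`, a fundamental domain for `ℤ^d`-periodic functions. -/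
def unitBox (d : ℕ) : Set (Fin d → ℝ) :=
  Set.univ.pi fun _ : Fin d => Set.Icc (0 : ℝ) 1

/-- The `k`-th Fourier coefficient `ĉ_k(f) = ∫_{[0,1]^d} f(x) e^{-2πi k·x} dx`. -/
noncomputable def torusCoeff {d : ℕ} (f : (Fin d → ℝ) → ℂ) (k : Fin d → ℤ) : ℂ :=
  ∫ x in unitBox d,
    f x * Complex.exp (-(2 * Real.pi * Complex.I) * (∑ i, (k i : ℂ) * (x i : ℂ)))

/-- The Laplacian `Δ g = ∑ i ∂²g/∂x_i²` of a scalar function on `ℝ^d`. -/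
noncomputable def lapPi {d : ℕ} (g : (Fin d → ℝ) → ℝ) (x : Fin d → ℝ) : ℝ :=
  ∑ i : Fin d, iteratedFDeriv ℝ 2 g x ![Pi.single i (1 : ℝ), Pi.single i (1 : ℝ)]

namespace Bern

open Set

/-- Periodicity with respect to the integer lattice. -/
def Per {d : ℕ} {E : Type*} (f : (Fin d → ℝ) → E) : Prop :=
  ∀ (x : Fin d → ℝ) (k : Fin d → ℤ), f (x + fun i => (k i : ℝ)) = f x

/-- Character. -/
noncomputable def ee {d : ℕ} (k : Fin d → ℤ) (x : Fin d → ℝ) : ℂ :=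
  Complex.exp ((2 * Real.pi * Complex.I) * (∑ i, (k i : ℂ) * (x i : ℂ)))

section Torus

noncomputable local instance instMS : MeasureSpace UnitAddCircle := ⟨AddCircle.haarAddCircle⟩

local instance instHaar : Measure.IsAddHaarMeasure (volume : Measure UnitAddCircle) :=
  inferInstanceAs (Measure.IsAddHaarMeasure AddCircle.haarAddCircle)

local instance instProb : IsProbabilityMeasure (volume : Measure UnitAddCircle) :=
  inferInstanceAs (IsProbabilityMeasure AddCircle.haarAddCircle)

/-- projection to torus -/
def proj {d : ℕ} (x : Fin d → ℝ) : UnitAddTorus (Fin d) := fun i => (x i : UnitAddCircle)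

lemma proj_quot {d : ℕ} : IsOpenQuotientMap (proj (d := d)) := by
  have := IsOpenQuotientMap.piMap (A := fun _ : Fin d => ℝ) (B := fun _ : Fin d => UnitAddCircle)
    (f := fun _ x => (x : UnitAddCircle)) (fun i => QuotientAddGroup.isOpenQuotientMap_mk)
  exact this

lemma proj_eq {d : ℕ} {x y : Fin d → ℝ} (h : proj x = proj y) :
    ∃ k : Fin d → ℤ, x = y + fun i => (k i : ℝ) := by
  have : ∀ i, ∃ k : ℤ, x i = y i + k := by
    intro i
    have hi := congrFun h i
    simp only [proj] at hi
    have h2 := (QuotientAddGroup.eq_iff_sub_mem).1 hi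
    obtain ⟨k, hk⟩ := AddSubgroup.mem_zmultiples_iff.1 h2
    exact ⟨k, by simp at hk; linarith⟩
  choose k hk using this
  exact ⟨k, funext hk⟩

lemma exists_lift {d : ℕ} {E : Type*} [TopologicalSpace E] {f : (Fin d → ℝ) → E}
    (hc : Continuous f) (hf : Per f) :
    ∃ F : C(UnitAddTorus (Fin d), E), ∀ x, F (proj x) = f x := by
  refine ⟨⟨fun t => f (Function.surjInv proj_quot.surjective t), ?_⟩, ?_⟩
  · rw [proj_quot.isQuotientMap.continuous_iff]
    convert hc using 1
    ext x
    obtain ⟨k, hk⟩ := proj_eq (Function.surjInv_eq proj_quot.surjective (proj x))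
    simp only [Function.comp]
    rw [hk, hf]
  · intro x
    obtain ⟨k, hk⟩ := proj_eq (Function.surjInv_eq proj_quot.surjective (proj x))
    simp only [ContinuousMap.coe_mk]
    rw [hk, hf]

lemma box_ae {d : ℕ} : (unitBox d) =ᵐ[volume]
    {x : Fin d → ℝ | ∀ i, x i ∈ Ioc ((0 : Fin d → ℝ) i) ((0 : Fin d → ℝ) i + 1)} := by
  have : {x : Fin d → ℝ | ∀ i, x i ∈ Ioc ((0 : Fin d → ℝ) i) ((0 : Fin d → ℝ) i + 1)}
      = Set.univ.pi fun _ : Fin d => Set.Ioc (0 : ℝ) 1 := by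
    ext x; simp
  rw [this, unitBox]
  have h := (Measure.univ_pi_Ioc_ae_eq_Icc (μ := fun _ : Fin d => (volume : Measure ℝ))
    (f := fun _ => 0) (g := fun _ => 1)).symm
  rw [Set.pi_univ_Icc]
  exact h

lemma box_integral {d : ℕ} {E : Type*} [NormedAddCommGroup E] [NormedSpace ℝ E]
    (F : UnitAddTorus (Fin d) → E) :
    ∫ x in unitBox d, F (proj x) = ∫ t, F t := by
  rw [setIntegral_congr_set box_ae, UnitAddTorus.integral_preimage F 0]
  rfl

lemma box_translate {d : ℕ} {f : (Fin d → ℝ) → ℝ}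
    (hc : Continuous f) (hf : Per f) (a : Fin d → ℝ) :
    ∫ x in unitBox d, f (x + a) = ∫ x in unitBox d, f x := by
  obtain ⟨F, hF⟩ := exists_lift hc hf
  have e1 : ∀ x, f (x + a) = (fun t => F (t + proj a)) (proj x) := by
    intro x; rw [← hF]; rfl
  simp_rw [e1]
  rw [box_integral (fun t => F (t + proj a))]
  simp_rw [← hF]
  rw [box_integral]
  exact integral_add_right_eq_self (μ := (volume : Measure (UnitAddTorus (Fin d)))) (fun t => F t) (proj a)

lemma mFourier_proj {d : ℕ} (k : Fin d → ℤ) (x : Fin d → ℝ) :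
    UnitAddTorus.mFourier k (proj x) = ee k x := by
  simp only [UnitAddTorus.mFourier, ee, ContinuousMap.coe_mk, proj, fourier_coe_apply]
  rw [← Complex.exp_sum, Finset.mul_sum]
  congr 1
  refine Finset.sum_congr rfl fun i _ => ?_
  simp; ring

lemma trig_expansion {d : ℕ} {f : (Fin d → ℝ) → ℝ} (hc : Continuous f) (hf : Per f)
    (S : Finset (Fin d → ℤ)) (hS : ∀ k ∉ S, torusCoeff (fun x => (f x : ℂ)) k = 0) :
    ∀ x, (f x : ℂ) = ∑ k ∈ S, torusCoeff (fun x => (f x : ℂ)) k * ee k x := by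
  intro x
  obtain ⟨F, hF⟩ := exists_lift (f := fun x => (f x : ℂ)) (by fun_prop)
    (fun x k => by simp [hf x k])
  have hco : ∀ k, UnitAddTorus.mFourierCoeff F k = torusCoeff (fun x => (f x : ℂ)) k := by
    intro k
    rw [UnitAddTorus.mFourierCoeff, ← box_integral (d := d), torusCoeff]
    congr 1
    ext x
    rw [mFourier_proj, hF, smul_eq_mul, mul_comm, ee]
    simp
  have hs : Summable (UnitAddTorus.mFourierCoeff F) :=
    summable_of_ne_finset_zero (s := S) (fun k hk => by rw [hco, hS k hk])
  have h1 := UnitAddTorus.hasSum_mFourier_series_apply_of_summable hs (proj x)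
  have h2 := hasSum_sum_of_ne_finset_zero (s := S) (L := SummationFilter.unconditional _)
    (f := fun i => UnitAddTorus.mFourierCoeff F i • UnitAddTorus.mFourier i (proj x))
    (fun k hk => by rw [hco, hS k hk, zero_smul])
  have h3 := h1.unique h2
  rw [hF] at h3
  rw [h3]
  refine Finset.sum_congr rfl fun k _ => ?_
  rw [hco, mFourier_proj, smul_eq_mul]

end Torus


section Calc

/-- partial derivative -/
noncomputable def pd {d : ℕ} (i : Fin d) (u : (Fin d → ℝ) → ℝ) (x : Fin d → ℝ) : ℝ :=
  fderiv ℝ u x (Pi.single i 1)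

lemma box_compact {d : ℕ} : IsCompact (unitBox d) := by
  rw [unitBox]
  exact isCompact_univ_pi fun _ => isCompact_Icc

lemma box_meas {d : ℕ} : MeasurableSet (unitBox d) := box_compact.measurableSet

lemma box_int {d : ℕ} {E : Type*} [NormedAddCommGroup E] {u : (Fin d → ℝ) → E} (h : Continuous u) :
    IntegrableOn u (unitBox d) :=
  h.continuousOn.integrableOn_compact box_compact

lemma pd_cont {d : ℕ} (i : Fin d) {u : (Fin d → ℝ) → ℝ} (h : ContDiff ℝ 1 u) :
    Continuous (pd i u) := by
  unfold pd
  exact (h.continuous_fderiv (by simp)).clm_apply continuous_const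

lemma pd_per {d : ℕ} (i : Fin d) {u : (Fin d → ℝ) → ℝ} (h : Per u) : Per (pd i u) := by
  intro x k
  unfold pd
  rw [← fderiv_comp_add_right]
  have : (fun y => u (y + fun i => (k i : ℝ))) = u := funext fun y => h y k
  rw [this]

lemma pd_mul {d : ℕ} (i : Fin d) {u v : (Fin d → ℝ) → ℝ} (hu : ContDiff ℝ 1 u)
    (hv : ContDiff ℝ 1 v) (x) : pd i (fun x => u x * v x) x = u x * pd i v x + pd i u x * v x := by
  unfold pd
  rw [fderiv_fun_mul (hu.differentiable (by simp) x) (hv.differentiable (by simp) x)]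
  simp [mul_comm]

lemma box_pd_zero {d : ℕ} (i : Fin d) {u : (Fin d → ℝ) → ℝ} (hu : ContDiff ℝ 1 u) (hp : Per u) :
    ∫ x in unitBox d, pd i u x = 0 := by
  have hc := pd_cont i hu
  let e : Fin d → ℝ := Pi.single i 1
  have h0 : ∀ x : Fin d → ℝ, ∫ t in (0:ℝ)..1, pd i u (x + t • e) = 0 := by
    intro x
    have hd : ∀ t ∈ Set.uIcc (0:ℝ) 1, HasDerivAt (fun t : ℝ => u (x + t • e)) (pd i u (x + t • e)) t := by
      intro t _
      have h1 : HasDerivAt (fun t : ℝ => x + t • e) e t := by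
        simpa using ((hasDerivAt_id t).smul_const e).const_add x
      exact ((hu.differentiable (by simp) (x + t • e)).hasFDerivAt).comp_hasDerivAt t h1
    rw [intervalIntegral.integral_eq_sub_of_hasDerivAt hd]
    · have := hp x (Pi.single i 1)
      have h2 : (fun j => ((Pi.single i (1:ℤ) : Fin d → ℤ) j : ℝ)) = e := by
        ext j
        by_cases h : j = i
        · subst h; simp [e]
        · simp [e, h]
      rw [h2] at this
      simp [this]
    · apply Continuous.intervalIntegrable
      fun_prop
  have h1 : ∫ x in unitBox d, ∫ t in (0:ℝ)..1, pd i u (x + t • e) = 0 := by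
    simp [h0]
  have h2 : ∀ t : ℝ, ∫ x in unitBox d, pd i u (x + t • e) = ∫ x in unitBox d, pd i u x :=
    fun t => box_translate hc (pd_per i hp) _
  simp_rw [intervalIntegral.integral_of_le zero_le_one] at h1
  rw [integral_integral_swap] at h1
  · simp_rw [h2] at h1
    simpa using h1
  · rw [Measure.prod_restrict]
    have hcc : Continuous (fun z : (Fin d → ℝ) × ℝ => pd i u (z.1 + z.2 • e)) := by fun_prop
    exact (hcc.continuousOn.integrableOn_compact
      (box_compact.prod (isCompact_Icc (a := (0:ℝ)) (b := 1)))).mono_set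
      (Set.prod_mono le_rfl Set.Ioc_subset_Icc_self)

lemma box_ibp {d : ℕ} (i : Fin d) {u v : (Fin d → ℝ) → ℝ} (hu : ContDiff ℝ 1 u)
    (hv : ContDiff ℝ 1 v) (hpu : Per u) (hpv : Per v) :
    ∫ x in unitBox d, pd i u x * v x = - ∫ x in unitBox d, u x * pd i v x := by
  have h := box_pd_zero i (hu.mul hv) (fun x k => by simp [hpu x k, hpv x k])
  simp_rw [pd_mul i hu hv] at h
  rw [integral_add] at h
  · linarith
  · exact box_int (hu.continuous.mul (pd_cont i hv))
  · exact box_int ((pd_cont i hu).mul hv.continuous)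

lemma pd_contDiff {d : ℕ} (i : Fin d) {u : (Fin d → ℝ) → ℝ} (h : ContDiff ℝ (⊤ : ℕ∞) u) :
    ContDiff ℝ (⊤ : ℕ∞) (pd i u) := by
  unfold pd
  exact (h.fderiv_right (m := (⊤ : ℕ∞)) (by simp)).clm_apply contDiff_const

lemma lap_eq {d : ℕ} {u : (Fin d → ℝ) → ℝ} (h : ContDiff ℝ (⊤ : ℕ∞) u) (x) :
    lapPi u x = ∑ i, pd i (pd i u) x := by
  unfold lapPi
  refine Finset.sum_congr rfl fun i _ => ?_
  rw [iteratedFDeriv_two_apply]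
  simp only [Matrix.cons_val_zero, Matrix.cons_val_one]
  unfold pd
  have hd : DifferentiableAt ℝ (fderiv ℝ u) x :=
    (h.fderiv_right (m := (⊤ : ℕ∞)) (by simp)).differentiable (by simp) x
  rw [fderiv_clm_apply hd (differentiableAt_const _)]
  simp

/-- weight -/
noncomputable def ww (p ε t : ℝ) : ℝ := (t ^ 2 + ε) ^ ((p - 2) / 2)

/-- derivative of the regularised nonlinearity -/
noncomputable def dphi (p ε t : ℝ) : ℝ :=
  ww p ε t + (p - 2) * (t ^ 2 * (t ^ 2 + ε) ^ ((p - 2) / 2 - 1))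

lemma ww_pos {p ε t : ℝ} (he : 0 < ε) : 0 < ww p ε t := by
  unfold ww; positivity

lemma ww_contDiff {p ε : ℝ} (he : 0 < ε) {d : ℕ} {f : (Fin d → ℝ) → ℝ} (hf : ContDiff ℝ 1 f) :
    ContDiff ℝ 1 (fun x => ww p ε (f x)) := by
  unfold ww
  exact ContDiff.rpow_const_of_ne (by fun_prop) (fun x => by positivity)

lemma phi_deriv {p ε : ℝ} (he : 0 < ε) (t : ℝ) :
    HasDerivAt (fun t => ww p ε t * t) (dphi p ε t) t := by
  unfold ww
  have h1 : HasDerivAt (fun t : ℝ => t ^ 2 + ε) (2 * t) t := by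
    simpa using (hasDerivAt_pow 2 t).add_const ε
  have h2 := (h1.rpow_const (p := (p - 2) / 2) (Or.inl (by positivity))).mul (hasDerivAt_id t)
  refine h2.congr_deriv ?_
  simp [dphi, ww]
  ring

lemma dphi_aux {p ε t : ℝ} (he : 0 < ε) :
    0 ≤ t ^ 2 * (t ^ 2 + ε) ^ ((p - 2) / 2 - 1) ∧
    t ^ 2 * (t ^ 2 + ε) ^ ((p - 2) / 2 - 1) ≤ ww p ε t := by
  refine ⟨by positivity, ?_⟩
  have hpos : 0 < t ^ 2 + ε := by positivity
  rw [Real.rpow_sub_one hpos.ne', ww]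
  have : 0 ≤ (t ^ 2 + ε) ^ ((p - 2) / 2) := by positivity
  rw [mul_div_assoc', div_le_iff₀ hpos]
  nlinarith

lemma pd_phi {p ε : ℝ} (he : 0 < ε) {d : ℕ} {f : (Fin d → ℝ) → ℝ} (hf : ContDiff ℝ 1 f)
    (i : Fin d) (x) :
    pd i (fun x => ww p ε (f x) * f x) x = dphi p ε (f x) * pd i f x := by
  unfold pd
  have h1 := ((hf.differentiable (by simp) x).hasFDerivAt)
  have h2 := (phi_deriv (p := p) he (f x)).comp_hasFDerivAt x h1
  have h3 := h2.fderiv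
  simp only [Function.comp_def] at h3
  rw [h3]
  simp

lemma dphi_cont {p ε : ℝ} (he : 0 < ε) : Continuous (dphi p ε) := by
  unfold dphi ww
  have h0 : Continuous fun t : ℝ => t ^ 2 + ε := by fun_prop
  have h1 : ∀ r : ℝ, Continuous (fun t : ℝ => (t ^ 2 + ε) ^ r) := fun r =>
    h0.rpow_const (fun t => Or.inl (by positivity))
  exact (h1 _).add (continuous_const.mul ((continuous_pow 2).mul (h1 _)))

lemma energy {p ε : ℝ} (he : 0 < ε) {d : ℕ} {f : (Fin d → ℝ) → ℝ}
    (hf : ContDiff ℝ (⊤ : ℕ∞) f) (hp : Per f) :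
    ∫ x in unitBox d, (-lapPi f x) * (ww p ε (f x) * f x) =
      ∑ i, ∫ x in unitBox d, dphi p ε (f x) * (pd i f x) ^ 2 := by
  have hf1 : ContDiff ℝ 1 f := hf.of_le (by exact_mod_cast le_top)
  have hφ : ContDiff ℝ 1 (fun x => ww p ε (f x) * f x) := (ww_contDiff he hf1).mul hf1
  have hi : ∀ i, ContDiff ℝ 1 (pd i f) := fun i =>
    (pd_contDiff i hf).of_le (by exact_mod_cast le_top)
  simp_rw [lap_eq hf, ← Finset.sum_neg_distrib, Finset.sum_mul]
  rw [integral_finsetSum]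
  · refine Finset.sum_congr rfl fun i _ => ?_
    have h := box_ibp i (hi i) hφ (pd_per i hp) (fun x k => by simp [hp x k])
    simp_rw [neg_mul]
    rw [integral_neg, h, neg_neg]
    congr 1
    ext x
    rw [pd_phi he hf1]
    ring
  · intro i _
    exact box_int ((pd_cont i (hi i)).neg.mul hφ.continuous)

end Calc


section Kernel

lemma per_bdd {d : ℕ} {h : (Fin d → ℝ) → ℝ} (hc : Continuous h) (hp : Per h) :
    ∃ C, ∀ x, |h x| ≤ C := by
  obtain ⟨F, hF⟩ := exists_lift hc hp
  refine ⟨‖F‖, fun x => ?_⟩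
  rw [← hF, ← Real.norm_eq_abs]
  exact F.norm_coe_le_norm _

lemma lp_bound {d : ℕ} {Y : Type*} [TopologicalSpace Y] [SecondCountableTopology Y]
    [MeasurableSpace Y] [OpensMeasurableSpace Y]
    (μ : Measure Y) [IsFiniteMeasure μ] {p q : ℝ} (hpq : p.HolderConjugate q)
    {a : Y → Fin d → ℝ} (ha : Continuous a)
    {h u : (Fin d → ℝ) → ℝ} (hc : Continuous h) (hp : Per h) (huc : Continuous u)
    (hu : ∀ x, |u x| ≤ ∫ y, |h (x + a y)| ∂μ) :
    ∫ x in unitBox d, |u x| ^ p ≤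
      (μ.real Set.univ ^ (1 / q)) ^ p * μ.real Set.univ * ∫ x in unitBox d, |h x| ^ p := by
  obtain ⟨C, hC⟩ := per_bdd hc hp
  have hp0 : 0 < p := hpq.pos
  have hq0 : 0 < q := hpq.symm.pos
  set M := μ.real Set.univ with hM
  have hM0 : 0 ≤ M := measureReal_nonneg
  have hhp : Continuous (fun x => |h x| ^ p) :=
    hc.abs.rpow_const (fun x => Or.inr hp0.le)
  have hhpp : Per (fun x => |h x| ^ p) := fun x k => by simp [hp x k]
  have hb : ∀ x, ‖|h x| ^ p‖ ≤ C ^ p := by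
    intro x
    rw [Real.norm_of_nonneg (by positivity)]
    exact Real.rpow_le_rpow (abs_nonneg _) (hC x) hp0.le
  have hpt : ∀ x, |u x| ^ p ≤ (M ^ (1 / q)) ^ p * ∫ y, |h (x + a y)| ^ p ∂μ := by
    intro x
    have h1 := integral_mul_le_Lp_mul_Lq_of_nonneg (μ := μ) hpq (f := fun y => |h (x + a y)|)
      (g := fun _ => 1) (Filter.Eventually.of_forall fun _ => abs_nonneg _)
      (Filter.Eventually.of_forall fun _ => zero_le_one)
      (MemLp.of_bound (Continuous.aestronglyMeasurable (by fun_prop)) C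
        (Filter.Eventually.of_forall fun y => by simpa using hC _))
      (memLp_const 1)
    simp only [mul_one, Real.one_rpow, integral_const, smul_eq_mul] at h1
    have h2 := (hu x).trans h1
    have h3 := Real.rpow_le_rpow (abs_nonneg _) h2 hp0.le
    have hI : 0 ≤ ∫ y, |h (x + a y)| ^ p ∂μ := integral_nonneg fun _ => by positivity
    rw [Real.mul_rpow (by positivity) (by positivity), ← Real.rpow_mul hI,
      one_div_mul_cancel hp0.ne', Real.rpow_one, mul_comm] at h3
    exact h3
  have hF : Integrable (fun z : (Fin d → ℝ) × Y => |h (z.1 + a z.2)| ^ p)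
      ((volume.restrict (unitBox d)).prod μ) := by
    have : IsFiniteMeasure (volume.restrict (unitBox d)) :=
      ⟨by simpa using box_compact.measure_lt_top⟩
    have hcc : Continuous (fun z : (Fin d → ℝ) × Y => |h (z.1 + a z.2)| ^ p) :=
      hhp.comp (continuous_fst.add (ha.comp continuous_snd))
    exact Integrable.of_bound hcc.aestronglyMeasurable (C ^ p)
      (Filter.Eventually.of_forall fun z => hb _)
  calc ∫ x in unitBox d, |u x| ^ p
      ≤ ∫ x in unitBox d, (M ^ (1 / q)) ^ p * ∫ y, |h (x + a y)| ^ p ∂μ := by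
        apply integral_mono
        · exact box_int (huc.abs.rpow_const (fun x => Or.inr hp0.le))
        · exact hF.integral_prod_left.const_mul _
        · exact hpt
    _ = (M ^ (1 / q)) ^ p * ∫ x in unitBox d, ∫ y, |h (x + a y)| ^ p ∂μ := integral_const_mul _ _
    _ = (M ^ (1 / q)) ^ p * ∫ y, (∫ x in unitBox d, |h (x + a y)| ^ p) ∂μ := by
        rw [integral_integral_swap hF]
    _ = _ := by
        have : ∀ y, ∫ x in unitBox d, |h (x + a y)| ^ p = ∫ x in unitBox d, |h x| ^ p :=
          fun y => box_translate hhp hhpp (a y)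
        simp_rw [this]
        rw [integral_const, smul_eq_mul, mul_assoc]

open scoped FourierTransform SchwartzMap

lemma exists_schwartz (d : ℕ) : ∃ Ψ : Fin d → 𝓢(EuclideanSpace ℝ (Fin d), ℂ),
    ∀ ξ : EuclideanSpace ℝ (Fin d), 1 ≤ ‖ξ‖ → ‖ξ‖ ≤ 2 →
      ∑ i, (2 * Real.pi * Complex.I * (ξ i : ℂ)) * (𝓕 (Ψ i : EuclideanSpace ℝ (Fin d) → ℂ) ξ) = 1 := by
  classical
  let b1 : ContDiffBump (0 : EuclideanSpace ℝ (Fin d)) := ⟨1/2, 1, by norm_num, by norm_num⟩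
  let b2 : ContDiffBump (0 : EuclideanSpace ℝ (Fin d)) := ⟨2, 3, by norm_num, by norm_num⟩
  have hden : ∀ ξ : EuclideanSpace ℝ (Fin d), 0 < ‖ξ‖ ^ 2 + b1 ξ := by
    intro ξ
    by_cases h : ξ = 0
    · subst h
      have : b1 0 = 1 := b1.one_of_mem_closedBall (by simp [b1])
      simp [this]
    · have : 0 < ‖ξ‖ := norm_pos_iff.2 h
      have := b1.nonneg (x := ξ)
      positivity
  let mr : Fin d → EuclideanSpace ℝ (Fin d) → ℝ := fun i ξ => b2 ξ * (ξ i / (‖ξ‖ ^ 2 + b1 ξ))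
  have hmr : ∀ i, ContDiff ℝ (⊤ : ℕ∞) (mr i) := by
    intro i
    refine b2.contDiff.mul (ContDiff.div ?_ ?_ (fun ξ => (hden ξ).ne'))
    · exact (EuclideanSpace.proj (𝕜 := ℝ) i).contDiff
    · exact (contDiff_norm_sq ℝ).add b1.contDiff
  let m : Fin d → EuclideanSpace ℝ (Fin d) → ℂ := fun i ξ =>
    (2 * Real.pi * Complex.I)⁻¹ * (mr i ξ : ℂ)
  have hm : ∀ i, ContDiff ℝ (⊤ : ℕ∞) (m i) := fun i =>
    contDiff_const.mul (Complex.ofRealCLM.contDiff.comp (hmr i))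
  have hs : ∀ i, HasCompactSupport (m i) := by
    intro i
    have h1 : HasCompactSupport (mr i) := b2.hasCompactSupport.mul_right
    have h2 := h1.comp_left (g := fun t : ℝ => (2 * Real.pi * Complex.I)⁻¹ * (t : ℂ)) (by simp)
    exact h2
  refine ⟨fun i => 𝓕⁻ ((hs i).toSchwartzMap (hm i)), ?_⟩
  intro ξ h1 h2
  have hF : ∀ i, 𝓕 ((𝓕⁻ ((hs i).toSchwartzMap (hm i)) : 𝓢(EuclideanSpace ℝ (Fin d), ℂ)) :
      EuclideanSpace ℝ (Fin d) → ℂ) ξ = m i ξ := by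
    intro i
    rw [← SchwartzMap.fourier_coe, FourierTransform.fourier_fourierInv_eq]
    rfl
  simp_rw [hF]
  have hb1 : b1 ξ = 0 := b1.zero_of_le_dist (by simpa [b1] using h1)
  have hb2 : b2 ξ = 1 := b2.one_of_mem_closedBall (by simpa [b2] using h2)
  have hpi : (2 * Real.pi * Complex.I : ℂ) ≠ 0 := Complex.two_pi_I_ne_zero
  have hn : ‖ξ‖ ^ 2 ≠ 0 := by positivity
  have e : ∀ i, 2 * Real.pi * Complex.I * (ξ i : ℂ) * m i ξ = ((ξ i ^ 2 / ‖ξ‖ ^ 2 : ℝ) : ℂ) := by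
    intro i
    simp only [m, mr, hb1, hb2]
    push_cast
    field_simp
    ring
  simp_rw [e]
  rw [← Complex.ofReal_sum, ← Finset.sum_div, ← EuclideanSpace.real_norm_sq_eq, div_self hn]
  simp

lemma ee_add {d : ℕ} (k : Fin d → ℤ) (x y : Fin d → ℝ) : ee k (x + y) = ee k x * ee k y := by
  unfold ee
  rw [← Complex.exp_add]
  congr 1
  simp [mul_add, Finset.sum_add_distrib]

lemma ee_norm {d : ℕ} (k : Fin d → ℤ) (x : Fin d → ℝ) : ‖ee k x‖ = 1 := by
  unfold ee
  have : (2 * Real.pi * Complex.I) * (∑ i, (k i : ℂ) * (x i : ℂ))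
    = ((2 * Real.pi * ∑ i, (k i : ℝ) * x i : ℝ) : ℂ) * Complex.I := by
    push_cast; ring
  rw [this, Complex.norm_exp_ofReal_mul_I]

lemma ee_contDiff {d : ℕ} (k : Fin d → ℤ) : ContDiff ℝ (⊤ : ℕ∞) (ee k) := by
  unfold ee
  refine ContDiff.cexp (contDiff_const.mul (ContDiff.sum fun i _ => contDiff_const.mul ?_))
  exact Complex.ofRealCLM.contDiff.comp (contDiff_apply ℝ ℝ i)

lemma ee_int {d : ℕ} (k m : Fin d → ℤ) : ee k (fun i => (m i : ℝ)) = 1 := by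
  unfold ee
  rw [Complex.exp_eq_one_iff]
  exact ⟨∑ i, k i * m i, by push_cast; ring⟩

lemma ee_line {d : ℕ} (k : Fin d → ℤ) (x : Fin d → ℝ) (i : Fin d) :
    HasDerivAt (fun t : ℝ => ee k (x + t • Pi.single i (1:ℝ)))
      (2 * Real.pi * Complex.I * (k i : ℂ) * ee k x) 0 := by
  have h1 : ∀ t : ℝ, ee k (x + t • Pi.single i (1:ℝ)) =
      ee k x * Complex.exp ((2 * Real.pi * Complex.I * k i) * (t : ℂ)) := by
    intro t
    rw [ee_add]
    congr 1
    unfold ee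
    congr 1
    rw [Finset.sum_eq_single i]
    · simp; ring
    · intro j _ hj; simp [hj]
    · simp
  simp_rw [h1]
  have h2 : HasDerivAt (fun t : ℝ => (2 * Real.pi * Complex.I * k i) * (t : ℂ))
      (2 * Real.pi * Complex.I * k i) 0 := by
    simpa using (Complex.ofRealCLM.hasDerivAt (x := (0:ℝ))).const_mul (2 * Real.pi * Complex.I * k i)
  have h3 := (h2.cexp).const_mul (ee k x)
  refine h3.congr_deriv ?_
  simp; ring

lemma pd_line {d : ℕ} {u : (Fin d → ℝ) → ℝ} (hu : ContDiff ℝ 1 u) (x) (i : Fin d) :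
    HasDerivAt (fun t : ℝ => u (x + t • Pi.single i (1:ℝ))) (pd i u x) 0 := by
  have h1 : HasDerivAt (fun t : ℝ => x + t • (Pi.single i (1:ℝ) : Fin d → ℝ)) (Pi.single i 1) 0 := by
    simpa using ((hasDerivAt_id (0:ℝ)).smul_const (Pi.single i (1:ℝ) : Fin d → ℝ)).const_add x
  have h2 : HasFDerivAt u (fderiv ℝ u x) (x + (0:ℝ) • Pi.single i (1:ℝ)) := by
    simpa using (hu.differentiable (by simp) x).hasFDerivAt
  exact h2.comp_hasDerivAt (0:ℝ) h1

lemma trig_line {d : ℕ} (S : Finset (Fin d → ℤ)) (b : (Fin d → ℤ) → ℂ) (x) (i : Fin d) :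
    HasDerivAt (fun t : ℝ => ∑ k ∈ S, b k * ee k (x + t • Pi.single i (1:ℝ)))
      (∑ k ∈ S, (b k * (2 * Real.pi * Complex.I * (k i : ℂ))) * ee k x) 0 := by
  refine (HasDerivAt.fun_sum fun k _ => (ee_line k x i).const_mul (b k)).congr_deriv ?_
  refine Finset.sum_congr rfl fun k _ => by ring

lemma conv_trig {d : ℕ} (S : Finset (Fin d → ℤ)) (b : (Fin d → ℤ) → ℂ) (N : ℕ)
    (Ψ : 𝓢(EuclideanSpace ℝ (Fin d), ℂ)) (x : Fin d → ℝ) :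
    ∑ k ∈ S, b k * 𝓕 (Ψ : EuclideanSpace ℝ (Fin d) → ℂ)
        (WithLp.toLp 2 (fun i => (k i : ℝ) / N)) * ee k x
      = ∫ y, Ψ y * ∑ k ∈ S, b k * ee k (x + (-(N:ℝ)⁻¹) • y.ofLp) := by
  have hkint : ∀ k : Fin d → ℤ, Integrable (fun y : EuclideanSpace ℝ (Fin d) =>
      Ψ y * (b k * ee k (x + (-(N:ℝ)⁻¹) • y.ofLp))) := by
    intro k
    refine Ψ.integrable.mul_bdd (c := ‖b k‖) ?_ ?_
    · have := (ee_contDiff k).continuous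
      have h2 : Continuous (fun y : EuclideanSpace ℝ (Fin d) => y.ofLp) := PiLp.continuous_ofLp 2 _
      exact Continuous.aestronglyMeasurable (by fun_prop)
    · refine Filter.Eventually.of_forall fun y => ?_
      rw [norm_mul, ee_norm, mul_one]
  simp_rw [Finset.mul_sum]
  rw [integral_finsetSum _ (fun k _ => hkint k)]
  refine Finset.sum_congr rfl fun k _ => ?_
  rw [Real.fourier_eq', ← integral_const_mul, ← integral_mul_const]
  congr 1
  ext y
  rw [ee_add, smul_eq_mul]
  have : Complex.exp (((-2 * Real.pi * inner ℝ y (WithLp.toLp 2 (fun i => (k i : ℝ) / N)) : ℝ) : ℂ)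
      * Complex.I) = ee k ((-(N:ℝ)⁻¹) • y.ofLp) := by
    unfold ee
    congr 1
    simp only [PiLp.inner_apply, Pi.smul_apply, smul_eq_mul]
    push_cast
    simp only [Finset.mul_sum, Finset.sum_mul]
    refine Finset.sum_congr rfl fun i _ => ?_
    simp
    ring
  rw [this]
  ring

end Kernel


section Kernel2

open scoped FourierTransform SchwartzMap

lemma lp_trig {d : ℕ} {p : ℝ} (hp : 1 < p) (Ψ : 𝓢(EuclideanSpace ℝ (Fin d), ℂ)) :
    ∃ A : ℝ, 0 ≤ A ∧ ∀ (N : ℕ) (S : Finset (Fin d → ℤ)) (b : (Fin d → ℤ) → ℂ)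
      (h u : (Fin d → ℝ) → ℝ), Continuous h → Per h → Continuous u →
      (∀ x, (h x : ℂ) = ∑ k ∈ S, b k * ee k x) →
      (∀ x, u x = (∑ k ∈ S, b k * 𝓕 (Ψ : EuclideanSpace ℝ (Fin d) → ℂ)
        (WithLp.toLp 2 (fun i => (k i : ℝ) / N)) * ee k x).re) →
      ∫ x in unitBox d, |u x| ^ p ≤ A * ∫ x in unitBox d, |h x| ^ p := by
  let μ : Measure (EuclideanSpace ℝ (Fin d)) := volume.withDensity (fun y => (‖Ψ y‖₊ : ENNReal))
  have hfin : IsFiniteMeasure μ := isFiniteMeasure_withDensity (by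
    have := Ψ.integrable (μ := volume)
    exact this.2.ne)
  have hpq := Real.HolderConjugate.conjExponent hp
  refine ⟨(μ.real Set.univ ^ (1 / p.conjExponent)) ^ p * μ.real Set.univ, by positivity, ?_⟩
  intro N S b h u hc hper huc hh hu
  refine lp_bound μ hpq (a := fun y => (-(N:ℝ)⁻¹) • y.ofLp) ?_ hc hper huc ?_
  · have h2 : Continuous (fun y : EuclideanSpace ℝ (Fin d) => y.ofLp) := PiLp.continuous_ofLp 2 _
    fun_prop
  · intro x
    rw [hu, conv_trig]
    refine (Complex.abs_re_le_norm _).trans ((norm_integral_le_integral_norm _).trans_eq ?_)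
    rw [integral_withDensity_eq_integral_smul (Ψ.continuous.nnnorm.measurable)]
    congr 1
    ext y
    rw [← hh, norm_mul, Complex.norm_real, Real.norm_eq_abs]
    rfl

lemma kernel (d : ℕ) {p : ℝ} (hp : 1 < p) : ∃ A : ℝ, 0 ≤ A ∧ ∀ N : ℕ, 1 ≤ N →
    ∀ f : (Fin d → ℝ) → ℝ, ContDiff ℝ (⊤ : ℕ∞) f → Per f →
      (∀ k : Fin d → ℤ,
            (Real.sqrt (∑ i, (k i : ℝ) ^ 2) < (N : ℝ) ∨
              (2 * N : ℝ) < Real.sqrt (∑ i, (k i : ℝ) ^ 2)) →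
            torusCoeff (fun x => (f x : ℂ)) k = 0) →
      ∃ v : Fin d → (Fin d → ℝ) → ℝ, (∀ i, ContDiff ℝ (⊤ : ℕ∞) (v i)) ∧ (∀ i, Per (v i)) ∧
        (∀ x, (N : ℝ) * f x = ∑ i, pd i (v i) x) ∧
        (∀ i, ∫ x in unitBox d, |v i x| ^ p ≤ A * ∫ x in unitBox d, |f x| ^ p) ∧
        (∀ i, ∫ x in unitBox d, |pd i (v i) x| ^ p ≤ A * ∫ x in unitBox d, |pd i f x| ^ p) := by
  obtain ⟨Ψ, hΨ⟩ := exists_schwartz d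
  choose A hA0 hA using fun i => lp_trig hp (Ψ i)
  refine ⟨∑ i, A i, Finset.sum_nonneg fun i _ => hA0 i, ?_⟩
  intro N hN f hf hper hspec
  have hAle : ∀ i, A i ≤ ∑ i, A i := fun i =>
    Finset.single_le_sum (fun j _ => hA0 j) (Finset.mem_univ i)
  have hN0 : (0 : ℝ) < N := by exact_mod_cast hN
  have hf1 : ContDiff ℝ 1 f := hf.of_le (by exact_mod_cast le_top)
  set c := torusCoeff (fun x => (f x : ℂ)) with hc
  let S : Finset (Fin d → ℤ) := Fintype.piFinset fun _ => Finset.Icc (-(2 * N : ℤ)) (2 * N)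
  have hS : ∀ k ∉ S, c k = 0 := by
    intro k hk
    apply hspec k
    right
    simp only [S, Fintype.mem_piFinset, not_forall, Finset.mem_Icc] at hk
    obtain ⟨i, hi⟩ := hk
    have h1 : (2 * N : ℝ) < |(k i : ℝ)| := by
      have : (2 * N : ℤ) < |k i| := by
        rw [← abs_le] at hi
        exact not_le.1 hi
      exact_mod_cast this
    refine h1.trans_le ?_
    rw [← Real.sqrt_sq_eq_abs]
    exact Real.sqrt_le_sqrt (Finset.single_le_sum (f := fun i => (k i : ℝ) ^ 2)
      (fun j _ => sq_nonneg _) (Finset.mem_univ i))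
  have hexp := trig_expansion hf.continuous hper S hS
  rw [← hc] at hexp
  let m : Fin d → (Fin d → ℤ) → ℂ := fun i k => 𝓕 (Ψ i : EuclideanSpace ℝ (Fin d) → ℂ)
        (WithLp.toLp 2 (fun i => (k i : ℝ) / N))
  let v : Fin d → (Fin d → ℝ) → ℝ := fun i x => (∑ k ∈ S, c k * m i k * ee k x).re
  have hv : ∀ i, ContDiff ℝ (⊤ : ℕ∞) (v i) := fun i =>
    Complex.reCLM.contDiff.comp (ContDiff.sum fun k _ => contDiff_const.mul (ee_contDiff k))
  have hv1 : ∀ i, ContDiff ℝ 1 (v i) := fun i => (hv i).of_le (by exact_mod_cast le_top)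
  have hpv : ∀ i x, pd i (v i) x =
      (∑ k ∈ S, (c k * (2 * Real.pi * Complex.I * (k i : ℂ))) * m i k * ee k x).re := by
    intro i x
    have h1 := pd_line (hv1 i) x i
    have h2 := trig_line S (fun k => c k * m i k) x i
    have h3 := Complex.reCLM.hasFDerivAt.comp_hasDerivAt (0:ℝ) h2
    rw [h1.unique h3]
    simp only [Complex.reCLM_apply]
    congr 1
    refine Finset.sum_congr rfl fun k _ => by ring
  have hpf : ∀ i x, ((pd i f x : ℝ) : ℂ) =
      ∑ k ∈ S, (c k * (2 * Real.pi * Complex.I * (k i : ℂ))) * ee k x := by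
    intro i x
    have h1 := (pd_line hf1 x i).ofReal_comp
    have h2 := trig_line S c x i
    simp_rw [hexp] at h1
    exact h1.unique h2
  refine ⟨v, hv, ?_, ?_, ?_, ?_⟩
  · intro i x k
    simp only [v, ee_add, ee_int, mul_one]
  · intro x
    simp_rw [hpv]
    rw [← Complex.re_sum, Finset.sum_comm]
    have h1 : (N : ℝ) * f x = ((N : ℂ) * ∑ k ∈ S, c k * ee k x).re := by
      rw [← hexp]
      simp
    rw [h1, Finset.mul_sum]
    congr 1
    refine Finset.sum_congr rfl fun k _ => ?_
    by_cases hk : c k = 0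
    · simp [hk]
    · have h2 := mt (hspec k) hk
      push Not at h2
      have hnorm : ‖(WithLp.toLp 2 (fun i => (k i : ℝ) / N) : EuclideanSpace ℝ (Fin d))‖ =
          Real.sqrt (∑ i, (k i : ℝ) ^ 2) / N := by
        rw [EuclideanSpace.norm_eq]
        simp only [Real.norm_eq_abs, sq_abs, div_pow]
        rw [← Finset.sum_div, Real.sqrt_div' _ (by positivity), Real.sqrt_sq hN0.le]
      have h3 := hΨ (WithLp.toLp 2 (fun i => (k i : ℝ) / N))
        (by rw [hnorm, le_div_iff₀ hN0]; linarith [h2.1])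
        (by rw [hnorm, div_le_iff₀ hN0]; linarith [h2.2])
      calc (N : ℂ) * (c k * ee k x) = (N : ℂ) * (c k * ee k x) * 1 := by ring
        _ = _ := by
          rw [← h3, Finset.mul_sum]
          refine Finset.sum_congr rfl fun i _ => ?_
          have hNC : (N : ℂ) ≠ 0 := by exact_mod_cast hN0.ne'
          simp only [m]
          push_cast
          field_simp
  · intro i
    refine (hA i N S c f (v i) hf.continuous hper (hv i).continuous hexp (fun x => rfl)).trans ?_
    exact mul_le_mul_of_nonneg_right (hAle i) (integral_nonneg fun x => by positivity)
  · intro i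
    refine (hA i N S _ (pd i f) (pd i (v i)) (pd_cont i hf1) (pd_per i hper) (pd_cont i (hv1 i))
      (hpf i) (hpv i)).trans ?_
    exact mul_le_mul_of_nonneg_right (hAle i) (integral_nonneg fun x => by positivity)

end Kernel2


section Final

open Filter Topology

lemma phi_bound {p ε t : ℝ} (hp : 1 < p) (he : 0 < ε) (he1 : ε ≤ 1) :
    |ww p ε t * t| ≤ (t ^ 2 + 1) ^ ((p - 1) / 2) := by
  have hpos : 0 < t ^ 2 + ε := by positivity
  have h1 : |t| ≤ (t ^ 2 + ε) ^ (1 / 2 : ℝ) := by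
    rw [← Real.sqrt_eq_rpow]
    exact Real.abs_le_sqrt (by linarith)
  rw [abs_mul, abs_of_pos (ww_pos he)]
  calc ww p ε t * |t| ≤ (t ^ 2 + ε) ^ ((p - 2) / 2) * (t ^ 2 + ε) ^ (1 / 2 : ℝ) :=
        mul_le_mul_of_nonneg_left h1 (ww_pos he).le
    _ = (t ^ 2 + ε) ^ ((p - 1) / 2) := by
        rw [← Real.rpow_add hpos]; congr 1; ring
    _ ≤ _ := Real.rpow_le_rpow hpos.le (by linarith) (by linarith)

lemma ww_cont {p ε : ℝ} (he : 0 < ε) {d : ℕ} {f : (Fin d → ℝ) → ℝ} (hf : Continuous f) :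
    Continuous (fun x => ww p ε (f x)) := by
  unfold ww
  exact Continuous.rpow_const (by fun_prop) (fun x => Or.inl (by positivity))

lemma phi_tendsto {p t : ℝ} :
    Tendsto (fun ε => ww p ε t * t) (𝓝[>] 0) (𝓝 (|t| ^ (p - 2) * t)) := by
  by_cases ht : t = 0
  · simp [ht]
  refine Tendsto.mul_const _ ?_
  have h1 : Tendsto (fun ε : ℝ => t ^ 2 + ε) (𝓝[>] 0) (𝓝 (t ^ 2)) := by
    have : Tendsto (fun ε : ℝ => t ^ 2 + ε) (𝓝 0) (𝓝 (t ^ 2 + 0)) :=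
      Continuous.tendsto (by fun_prop) 0
    rw [add_zero] at this
    exact this.mono_left nhdsWithin_le_nhds
  have h2 := h1.rpow_const (p := (p - 2) / 2) (Or.inl (by positivity))
  have h3 : (t ^ 2) ^ ((p - 2) / 2) = |t| ^ (p - 2) := by
    rw [← sq_abs, ← Real.rpow_natCast, ← Real.rpow_mul (abs_nonneg _)]
    congr 1; push_cast; ring
  rw [h3] at h2
  exact h2

lemma lim1 {p : ℝ} (hp : 1 < p) {d : ℕ} {f G : (Fin d → ℝ) → ℝ} (hf : Continuous f)
    (hG : Continuous G) :
    Tendsto (fun ε => ∫ x in unitBox d, G x * (ww p ε (f x) * f x)) (𝓝[>] 0)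
      (𝓝 (∫ x in unitBox d, G x * (|f x| ^ (p - 2) * f x))) := by
  refine tendsto_integral_filter_of_dominated_convergence
    (fun x => |G x| * (f x ^ 2 + 1) ^ ((p - 1) / 2)) ?_ ?_ ?_ ?_
  · filter_upwards [self_mem_nhdsWithin] with ε he
    exact (hG.mul ((ww_cont he hf).mul hf)).aestronglyMeasurable
  · have : Set.Ioc (0:ℝ) 1 ∈ 𝓝[>] (0:ℝ) := Ioc_mem_nhdsGT zero_lt_one
    filter_upwards [this] with ε he
    refine Eventually.of_forall fun x => ?_
    rw [norm_mul, Real.norm_eq_abs, Real.norm_eq_abs]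
    exact mul_le_mul_of_nonneg_left (phi_bound hp he.1 he.2) (abs_nonneg _)
  · refine box_int (hG.abs.mul (Continuous.rpow_const (by fun_prop) fun x => Or.inl (by positivity)))
  · exact Eventually.of_forall fun x => phi_tendsto.const_mul _

lemma pow_cont {p : ℝ} (hp : 1 < p) {d : ℕ} {f : (Fin d → ℝ) → ℝ} (hf : Continuous f) :
    Continuous (fun x => |f x| ^ p) :=
  hf.abs.rpow_const fun x => Or.inr (by linarith)

lemma lim2 {p : ℝ} (hp : 1 < p) {d : ℕ} {f : (Fin d → ℝ) → ℝ} (hf : Continuous f) :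
    Tendsto (fun ε => ∫ x in unitBox d, (f x ^ 2 + ε) ^ (p / 2)) (𝓝[>] 0)
      (𝓝 (∫ x in unitBox d, |f x| ^ p)) := by
  have hc : Continuous (fun ε => ∫ x in unitBox d, (f x ^ 2 + ε) ^ (p / 2)) := by
    refine continuous_parametric_integral_of_continuous
      (f := fun (ε : ℝ) (x : Fin d → ℝ) => (f x ^ 2 + ε) ^ (p / 2)) ?_ box_compact
    unfold Function.uncurry
    exact Continuous.rpow_const (by fun_prop) fun x => Or.inr (by linarith)
  have h := (hc.tendsto 0).mono_left (nhdsWithin_le_nhds (s := Set.Ioi 0))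
  have h3 : ∀ t : ℝ, (t ^ 2) ^ (p / 2) = |t| ^ p := by
    intro t
    rw [← sq_abs, ← Real.rpow_natCast, ← Real.rpow_mul (abs_nonneg _)]
    congr 1; push_cast; ring
  simpa only [add_zero, h3] using h

lemma phi_self {p : ℝ} (hp : 1 < p) (t : ℝ) : t * (|t| ^ (p - 2) * t) = |t| ^ p := by
  by_cases ht : t = 0
  · simp [ht, Real.zero_rpow (by linarith : p ≠ 0)]
  have h0 : 0 < |t| := abs_pos.2 ht
  have : t * (|t| ^ (p - 2) * t) = |t| ^ (p - 2) * |t| ^ (2 : ℝ) := by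
    rw [Real.rpow_two, sq_abs]; ring
  rw [this, ← Real.rpow_add h0]
  congr 1; ring

lemma lap_cont {d : ℕ} {f : (Fin d → ℝ) → ℝ} (hf : ContDiff ℝ (⊤ : ℕ∞) f) :
    Continuous (lapPi f) := by
  have : lapPi f = fun x => ∑ i, pd i (pd i f) x := funext fun x => lap_eq hf x
  rw [this]
  exact continuous_finsetSum _ fun i _ => (pd_contDiff i (pd_contDiff i hf)).continuous

lemma sqrt_ww {p ε t : ℝ} (he : 0 < ε) :
    ww p ε t = (Real.sqrt (t ^ 2 + ε)) ^ (p - 2) := by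
  have hpos : 0 < t ^ 2 + ε := by positivity
  rw [ww, Real.sqrt_eq_rpow, ← Real.rpow_mul hpos.le]
  congr 1; ring

lemma sqrt_pw {p ε t : ℝ} (he : 0 < ε) :
    (t ^ 2 + ε) ^ (p / 2) = (Real.sqrt (t ^ 2 + ε)) ^ p := by
  have hpos : 0 < t ^ 2 + ε := by positivity
  rw [Real.sqrt_eq_rpow, ← Real.rpow_mul hpos.le]
  congr 1; ring

/-- `s^{p-2} v^2 ≤ v^p + s^p` for `p ≥ 2`. -/
lemma pt_big {p s v : ℝ} (hp : 2 ≤ p) (hs : 0 < s) (hv : 0 ≤ v) :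
    s ^ (p - 2) * v ^ 2 ≤ v ^ p + s ^ p := by
  have e : ∀ r : ℝ, 0 < r → r ^ p = r ^ (p - 2) * r ^ 2 := by
    intro r hr
    rw [← Real.rpow_natCast, ← Real.rpow_add hr]
    congr 1; push_cast; ring
  rcases le_total v s with h | h
  · have h1 : s ^ (p - 2) * v ^ 2 ≤ s ^ p := by
      rw [e s hs]
      gcongr
    have : 0 ≤ v ^ p := by positivity
    linarith
  · have hv' : 0 < v := hs.trans_le h
    have h1 : s ^ (p - 2) * v ^ 2 ≤ v ^ p := by
      rw [e v hv']
      gcongr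
    have : 0 ≤ s ^ p := by positivity
    linarith

/-- `P^p ≤ r^p + r^{p-2} P^2` for `p ≤ 2`. -/
lemma pt_small {p r P : ℝ} (hp : 1 < p) (hp2 : p ≤ 2) (hr : 0 < r) (hP : 0 ≤ P) :
    P ^ p ≤ r ^ p + r ^ (p - 2) * P ^ 2 := by
  rcases le_total P r with h | h
  · have h1 : P ^ p ≤ r ^ p := Real.rpow_le_rpow hP h (by linarith)
    have : 0 ≤ r ^ (p - 2) * P ^ 2 := by positivity
    linarith
  · have hP' : 0 < P := hr.trans_le h
    have e : P ^ p = P ^ (p - 2) * P ^ 2 := by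
      rw [← Real.rpow_natCast, ← Real.rpow_add hP']
      congr 1; push_cast; ring
    have h1 : P ^ (p - 2) ≤ r ^ (p - 2) := Real.rpow_le_rpow_of_nonpos hr h (by linarith)
    have h2 : P ^ p ≤ r ^ (p - 2) * P ^ 2 := by
      rw [e]; gcongr
    have : 0 ≤ r ^ p := by positivity
    linarith

lemma pw_cont {p ε : ℝ} (he : 0 < ε) {d : ℕ} {f : (Fin d → ℝ) → ℝ} (hf : Continuous f) :
    Continuous (fun x => (f x ^ 2 + ε) ^ (p / 2)) :=
  Continuous.rpow_const (by fun_prop) (fun x => Or.inl (by positivity))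

lemma big_case {d : ℕ} {p : ℝ} (hp2 : 2 ≤ p) {A N : ℝ} (hN : 0 < N)
    {f : (Fin d → ℝ) → ℝ} (hf : ContDiff ℝ (⊤ : ℕ∞) f) (hper : Per f)
    {v : Fin d → (Fin d → ℝ) → ℝ} (hv : ∀ i, ContDiff ℝ (⊤ : ℕ∞) (v i)) (hvp : ∀ i, Per (v i))
    (hfv : ∀ x, N * f x = ∑ i, pd i (v i) x)
    (hA : ∀ i, ∫ x in unitBox d, |v i x| ^ p ≤ A * ∫ x in unitBox d, |f x| ^ p)
    {η : ℝ} (hη : 0 < η) :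
    N * ∫ x in unitBox d, |f x| ^ p ≤
      (p - 1) * η * N * (d * (A + 1)) * (∫ x in unitBox d, |f x| ^ p) +
      (p - 1) / (4 * η * N) * ∫ x in unitBox d, (-lapPi f x) * (|f x| ^ (p - 2) * f x) := by
  have hp : 1 < p := by linarith
  have hfc := hf.continuous
  have hf1 : ContDiff ℝ 1 f := hf.of_le (by exact_mod_cast le_top)
  have hv1 : ∀ i, ContDiff ℝ 1 (v i) := fun i => (hv i).of_le (by exact_mod_cast le_top)
  set F := ∫ x in unitBox d, |f x| ^ p with hF
  have L1 := lim1 hp hfc (lap_cont hf).neg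
  simp only [Pi.neg_apply] at L1
  have L2 := lim2 hp hfc
  have L3 := lim1 hp hfc hfc
  simp_rw [phi_self hp] at L3
  rw [← hF] at L2 L3
  have key : ∀ ε : ℝ, 0 < ε →
      N * ∫ x in unitBox d, f x * (ww p ε (f x) * f x) ≤
      (p - 1) * η * N * (d * (A * F + ∫ x in unitBox d, (f x ^ 2 + ε) ^ (p / 2))) +
      (p - 1) / (4 * η * N) * ∫ x in unitBox d, (-lapPi f x) * (ww p ε (f x) * f x) := by
    intro ε he
    have hφ : ContDiff ℝ 1 (fun x => ww p ε (f x) * f x) := (ww_contDiff he hf1).mul hf1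
    have hφp : Per (fun x => ww p ε (f x) * f x) := fun x k => by simp [hper x k]
    have hdc : Continuous fun x => dphi p ε (f x) := (dphi_cont he).comp hfc
    have e1 : N * ∫ x in unitBox d, f x * (ww p ε (f x) * f x) =
        ∑ i, ∫ x in unitBox d, -(v i x * (dphi p ε (f x) * pd i f x)) := by
      rw [← integral_const_mul]
      simp_rw [← mul_assoc N, hfv, Finset.sum_mul]
      rw [integral_finsetSum]
      · refine Finset.sum_congr rfl fun i _ => ?_
        rw [box_ibp i (hv1 i) hφ (hvp i) hφp, integral_neg]
        simp_rw [pd_phi he hf1]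
      · intro i _
        exact box_int ((pd_cont i (hv1 i)).mul hφ.continuous)
    rw [e1, energy he hf hper]
    have e2 : ∀ i, ∫ x in unitBox d, -(v i x * (dphi p ε (f x) * pd i f x)) ≤
        (p - 1) * η * N * (A * F + ∫ x in unitBox d, (f x ^ 2 + ε) ^ (p / 2)) +
        (p - 1) / (4 * η * N) * ∫ x in unitBox d, dphi p ε (f x) * pd i f x ^ 2 := by
      intro i
      have hvi := pow_cont hp (hv i).continuous
      have hpw : Continuous (fun x => (f x ^ 2 + ε) ^ (p / 2)) := pw_cont he hfc
      have hdp : Continuous (fun x => dphi p ε (f x) * pd i f x ^ 2) :=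
        hdc.mul ((pd_cont i hf1).pow 2)
      have e3 : ∫ x in unitBox d, -(v i x * (dphi p ε (f x) * pd i f x)) ≤
          ∫ x in unitBox d, ((p - 1) * η * N * (|v i x| ^ p + (f x ^ 2 + ε) ^ (p / 2)) +
            (p - 1) / (4 * η * N) * (dphi p ε (f x) * pd i f x ^ 2)) := by
        apply integral_mono
        · exact box_int ((hv i).continuous.mul (hdc.mul (pd_cont i hf1))).neg
        · exact box_int ((continuous_const.mul (hvi.add hpw)).add (continuous_const.mul hdp))
        · intro x
          simp only
          obtain ⟨a1, a2⟩ := dphi_aux (p := p) (ε := ε) (t := f x) he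
          have b1 : ww p ε (f x) ≤ dphi p ε (f x) := by
            unfold dphi; nlinarith
          have b2 : dphi p ε (f x) ≤ (p - 1) * ww p ε (f x) := by
            unfold dphi; nlinarith
          have b0 := ww_pos (p := p) (t := f x) he
          have b3 : ww p ε (f x) * v i x ^ 2 ≤ |v i x| ^ p + (f x ^ 2 + ε) ^ (p / 2) := by
            rw [sqrt_ww he, sqrt_pw he, ← sq_abs (v i x)]
            exact pt_big hp2 (Real.sqrt_pos.2 (by positivity)) (abs_nonneg _)
          set w := ww p ε (f x)
          set D := dphi p ε (f x)
          set P := pd i f x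
          set V := v i x
          have hD : 0 ≤ D := b0.le.trans b1
          have c1 : -(V * (D * P)) ≤ D * (η * N * V ^ 2 + 1 / (4 * η * N) * P ^ 2) := by
            have : 0 ≤ η * N * V ^ 2 + 1 / (4 * η * N) * P ^ 2 + V * P := by
              have : η * N * V ^ 2 + 1 / (4 * η * N) * P ^ 2 + V * P =
                  η * N * (V + P / (2 * η * N)) ^ 2 := by
                field_simp; ring
              rw [this]; positivity
            nlinarith
          have c2 : D * (η * N * V ^ 2) ≤ (p - 1) * η * N * (|V| ^ p + (f x ^ 2 + ε) ^ (p / 2)) := by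
            calc D * (η * N * V ^ 2) ≤ ((p - 1) * w) * (η * N * V ^ 2) :=
                  mul_le_mul_of_nonneg_right b2 (by positivity)
              _ = ((p - 1) * η * N) * (w * V ^ 2) := by ring
              _ ≤ _ := mul_le_mul_of_nonneg_left b3
                  (mul_nonneg (mul_nonneg (by linarith) hη.le) hN.le)
          have c3 : D * (1 / (4 * η * N) * P ^ 2) ≤ (p - 1) / (4 * η * N) * (D * P ^ 2) := by
            have : (p - 1) / (4 * η * N) * (D * P ^ 2) - D * (1 / (4 * η * N) * P ^ 2)
                = (p - 2) * (D * P ^ 2 / (4 * η * N)) := by field_simp; ring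
            have h0 : 0 ≤ (p - 2) * (D * P ^ 2 / (4 * η * N)) :=
              mul_nonneg (by linarith) (by positivity)
            linarith
          linarith
      refine e3.trans ?_
      have i1 : IntegrableOn (fun x => (p - 1) * η * N * (|v i x| ^ p + (f x ^ 2 + ε) ^ (p / 2)))
          (unitBox d) := box_int (continuous_const.mul (hvi.add hpw))
      have i2 : IntegrableOn (fun x => (p - 1) / (4 * η * N) * (dphi p ε (f x) * pd i f x ^ 2))
          (unitBox d) := box_int (continuous_const.mul hdp)
      rw [integral_add i1 i2, integral_const_mul, integral_const_mul,
        integral_add (box_int hvi) (box_int hpw)]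
      have h0 : 0 ≤ (p - 1) * η * N := mul_nonneg (mul_nonneg (by linarith) hη.le) hN.le
      have := mul_le_mul_of_nonneg_left (hA i) h0
      linarith
    refine (Finset.sum_le_sum fun i _ => e2 i).trans_eq ?_
    rw [Finset.sum_add_distrib, Finset.sum_const, ← Finset.mul_sum, Finset.card_univ,
      Fintype.card_fin, nsmul_eq_mul]
    generalize (∫ x in unitBox d, (f x ^ 2 + ε) ^ (p / 2)) = G
    ring
  have hl := le_of_tendsto_of_tendsto (L3.const_mul N)
    ((((L2.const_add (A * F)).const_mul (d : ℝ)).const_mul ((p - 1) * η * N)).add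
      (L1.const_mul ((p - 1) / (4 * η * N))))
    (by filter_upwards [self_mem_nhdsWithin] with ε he using key ε he)
  refine hl.trans_eq ?_
  ring

lemma small_case {d : ℕ} {p : ℝ} (hp : 1 < p) (hp2 : p ≤ 2) {A N : ℝ} (hA0 : 0 ≤ A) (hN : 0 < N)
    {f : (Fin d → ℝ) → ℝ} (hf : ContDiff ℝ (⊤ : ℕ∞) f) (hper : Per f)
    {v : Fin d → (Fin d → ℝ) → ℝ} (hv : ∀ i, ContDiff ℝ (⊤ : ℕ∞) (v i))
    (hfv : ∀ x, N * f x = ∑ i, pd i (v i) x)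
    (hA : ∀ i, ∫ x in unitBox d, |pd i (v i) x| ^ p ≤ A * ∫ x in unitBox d, |pd i f x| ^ p)
    {η : ℝ} (hη : 0 < η) :
    N ^ p * ∫ x in unitBox d, |f x| ^ p ≤
      (d : ℝ) ^ (p - 1) * A * (d * (η * N) ^ p * (∫ x in unitBox d, |f x| ^ p) +
      (η * N) ^ (p - 2) / (p - 1) *
        ∫ x in unitBox d, (-lapPi f x) * (|f x| ^ (p - 2) * f x)) := by
  have hfc := hf.continuous
  have hf1 : ContDiff ℝ 1 f := hf.of_le (by exact_mod_cast le_top)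
  have hv1 : ∀ i, ContDiff ℝ 1 (v i) := fun i => (hv i).of_le (by exact_mod_cast le_top)
  have hηN : 0 < η * N := by positivity
  set F := ∫ x in unitBox d, |f x| ^ p with hF
  have L1 := lim1 hp hfc (lap_cont hf).neg
  simp only [Pi.neg_apply] at L1
  have L2 := lim2 hp hfc
  rw [← hF] at L2
  have key0 : N ^ p * F ≤ (d : ℝ) ^ (p - 1) * A * ∑ i, ∫ x in unitBox d, |pd i f x| ^ p := by
    have h1 : N ^ p * F ≤ ∫ x in unitBox d, (d : ℝ) ^ (p - 1) * ∑ i, |pd i (v i) x| ^ p := by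
      rw [hF, ← integral_const_mul]
      apply integral_mono
      · exact box_int (continuous_const.mul (pow_cont hp hfc))
      · exact box_int (continuous_const.mul
          (continuous_finsetSum _ fun i _ => pow_cont hp (pd_cont i (hv1 i))))
      · intro x
        simp only
        rw [← Real.mul_rpow hN.le (abs_nonneg _)]
        have h2 : N * |f x| ≤ ∑ i, |pd i (v i) x| := by
          have : N * |f x| = |N * f x| := by rw [abs_mul, abs_of_pos hN]
          rw [this, hfv]
          exact Finset.abs_sum_le_sum_abs _ _
        refine (Real.rpow_le_rpow (by positivity) h2 (by linarith)).trans ?_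
        have h3 := Real.rpow_sum_le_const_mul_sum_rpow (Finset.univ) (fun i => pd i (v i) x) hp.le
        simpa using h3
    rw [integral_const_mul, integral_finsetSum _
      (fun i _ => box_int (pow_cont hp (pd_cont i (hv1 i))))] at h1
    refine h1.trans ?_
    rw [mul_assoc, Finset.mul_sum (a := A)]
    gcongr with i _
    exact hA i
  have key : ∀ ε : ℝ, 0 < ε → N ^ p * F ≤
      (d : ℝ) ^ (p - 1) * A * (d * (η * N) ^ p * (∫ x in unitBox d, (f x ^ 2 + ε) ^ (p / 2)) +
      (η * N) ^ (p - 2) / (p - 1) *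
        ∫ x in unitBox d, (-lapPi f x) * (ww p ε (f x) * f x)) := by
    intro ε he
    refine key0.trans (mul_le_mul_of_nonneg_left ?_ (by positivity))
    have hdc : Continuous fun x => dphi p ε (f x) := (dphi_cont he).comp hfc
    rw [energy he hf hper]
    have e2 : ∀ i, ∫ x in unitBox d, |pd i f x| ^ p ≤
        (η * N) ^ p * (∫ x in unitBox d, (f x ^ 2 + ε) ^ (p / 2)) +
        (η * N) ^ (p - 2) / (p - 1) * ∫ x in unitBox d, dphi p ε (f x) * pd i f x ^ 2 := by
      intro i
      have hpw : Continuous (fun x => (f x ^ 2 + ε) ^ (p / 2)) := pw_cont he hfc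
      have hdp : Continuous (fun x => dphi p ε (f x) * pd i f x ^ 2) :=
        hdc.mul ((pd_cont i hf1).pow 2)
      have i1 : IntegrableOn (fun x => (η * N) ^ p * (f x ^ 2 + ε) ^ (p / 2)) (unitBox d) :=
        box_int (continuous_const.mul hpw)
      have i2 : IntegrableOn
          (fun x => (η * N) ^ (p - 2) / (p - 1) * (dphi p ε (f x) * pd i f x ^ 2)) (unitBox d) :=
        box_int (continuous_const.mul hdp)
      rw [← integral_const_mul, ← integral_const_mul, ← integral_add i1 i2]
      apply integral_mono
      · exact box_int (pow_cont hp (pd_cont i hf1))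
      · exact box_int ((continuous_const.mul hpw).add (continuous_const.mul hdp))
      · intro x
        simp only
        obtain ⟨a1, a2⟩ := dphi_aux (p := p) (ε := ε) (t := f x) he
        have b1 : (p - 1) * ww p ε (f x) ≤ dphi p ε (f x) := by
          unfold dphi; nlinarith
        have hs : 0 < Real.sqrt (f x ^ 2 + ε) := Real.sqrt_pos.2 (by positivity)
        have b2 := pt_small hp hp2 (mul_pos hηN hs) (abs_nonneg (pd i f x))
        rw [Real.mul_rpow hηN.le hs.le, Real.mul_rpow hηN.le hs.le, ← sqrt_ww he,
          ← sqrt_pw he, sq_abs] at b2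
        refine b2.trans (add_le_add le_rfl ?_)
        have hp1 : 0 < p - 1 := by linarith
        have b3 : ww p ε (f x) ≤ dphi p ε (f x) / (p - 1) := by
          rw [le_div_iff₀ hp1]; linarith
        calc (η * N) ^ (p - 2) * ww p ε (f x) * pd i f x ^ 2
            ≤ (η * N) ^ (p - 2) * (dphi p ε (f x) / (p - 1)) * pd i f x ^ 2 := by gcongr
          _ = _ := by ring
    refine (Finset.sum_le_sum fun i _ => e2 i).trans_eq ?_
    rw [Finset.sum_add_distrib, Finset.sum_const, ← Finset.mul_sum, Finset.card_univ,
      Fintype.card_fin, nsmul_eq_mul]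
    generalize (∫ x in unitBox d, (f x ^ 2 + ε) ^ (p / 2)) = G
    ring
  exact ge_of_tendsto (((L2.const_mul ((d : ℝ) * (η * N) ^ p)).add
      (L1.const_mul ((η * N) ^ (p - 2) / (p - 1)))).const_mul ((d : ℝ) ^ (p - 1) * A))
    (by filter_upwards [self_mem_nhdsWithin] with ε he using key ε he)

end Final

end Bern

theorem stmt_18 (d : ℕ) (hd : 1 ≤ d) (p : ℝ) (hp : 1 < p) :
    ∃ c : ℝ, 0 < c ∧
      ∀ N : ℕ, 2 ≤ N →
        ∀ f : (Fin d → ℝ) → ℝ,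
          ContDiff ℝ (⊤ : ℕ∞) f →
          (∀ (x : Fin d → ℝ) (k : Fin d → ℤ), f (x + fun i => (k i : ℝ)) = f x) →
          (∀ k : Fin d → ℤ,
            (Real.sqrt (∑ i, (k i : ℝ) ^ 2) < (N : ℝ) ∨
              (2 * N : ℝ) < Real.sqrt (∑ i, (k i : ℝ) ^ 2)) →
            torusCoeff (fun x => (f x : ℂ)) k = 0) →
          c * (N : ℝ) ^ 2 * (∫ x in unitBox d, |f x| ^ p) ≤
            ∫ x in unitBox d, (-lapPi f x) * (|f x| ^ (p - 2) * f x) := by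
  obtain ⟨A, hA0, hA⟩ := Bern.kernel d hp
  have hd0 : (0 : ℝ) < d := by exact_mod_cast hd
  have hp1 : 0 < p - 1 := by linarith
  rcases le_total 2 p with hp2 | hp2
  · set η : ℝ := 1 / (2 * (p - 1) * (d * (A + 1))) with hη
    have hη0 : 0 < η := by positivity
    refine ⟨2 * η / (p - 1), by positivity, ?_⟩
    intro N hN f hf hper hspec
    have hN0 : (0 : ℝ) < N := by exact_mod_cast (by omega : 0 < N)
    obtain ⟨v, hv, hvp, hfv, h1, -⟩ := hA N (by omega) f hf hper hspec
    have h := Bern.big_case hp2 hN0 hf hper hv hvp hfv h1 hη0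
    set F := ∫ x in unitBox d, |f x| ^ p
    set J := ∫ x in unitBox d, (-lapPi f x) * (|f x| ^ (p - 2) * f x)
    have e1 : (p - 1) * η * N * (d * (A + 1)) = N / 2 := by
      rw [hη]; field_simp
    rw [e1] at h
    have h2 : (N : ℝ) / 2 * F ≤ (p - 1) / (4 * η * N) * J := by linarith
    have h3 := mul_le_mul_of_nonneg_left h2 (by positivity : 0 ≤ 4 * η * N / (p - 1))
    have e2 : 4 * η * N / (p - 1) * ((p - 1) / (4 * η * N) * J) = J := by field_simp
    have e3 : 4 * η * N / (p - 1) * ((N : ℝ) / 2 * F) = 2 * η / (p - 1) * (N : ℝ) ^ 2 * F := by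
      ring
    rw [e2, e3] at h3
    exact h3
  · set D : ℝ := (d : ℝ) ^ (p - 1) with hD
    have hD0 : 0 < D := by positivity
    set η : ℝ := (1 / (2 * D * (A + 1) * d)) ^ (1 / p) with hη
    have hη0 : 0 < η := by positivity
    refine ⟨(p - 1) / (2 * D * (A + 1) * η ^ (p - 2)), by positivity, ?_⟩
    intro N hN f hf hper hspec
    have hN0 : (0 : ℝ) < N := by exact_mod_cast (by omega : 0 < N)
    obtain ⟨v, hv, hvp, hfv, -, h1⟩ := hA N (by omega) f hf hper hspec
    have h1' : ∀ i, ∫ x in unitBox d, |Bern.pd i (v i) x| ^ p ≤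
        (A + 1) * ∫ x in unitBox d, |Bern.pd i f x| ^ p := fun i =>
      (h1 i).trans (mul_le_mul_of_nonneg_right (by linarith)
        (integral_nonneg fun x => by positivity))
    have h := Bern.small_case hp hp2 (by linarith : 0 ≤ A + 1) hN0 hf hper hv hfv h1' hη0
    set F := ∫ x in unitBox d, |f x| ^ p
    set J := ∫ x in unitBox d, (-lapPi f x) * (|f x| ^ (p - 2) * f x)
    rw [← hD, Real.mul_rpow hη0.le hN0.le, Real.mul_rpow hη0.le hN0.le] at h
    have e0 : η ^ p = 1 / (2 * D * (A + 1) * d) := by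
      rw [hη, ← Real.rpow_mul (by positivity), one_div_mul_cancel (by linarith), Real.rpow_one]
    have e1 : (N : ℝ) ^ p = (N : ℝ) ^ (p - 2) * (N : ℝ) ^ 2 := by
      rw [← Real.rpow_natCast, ← Real.rpow_add hN0]
      congr 1; push_cast; ring
    have hM : 0 < (N : ℝ) ^ (p - 2) := by positivity
    have hE : 0 < η ^ (p - 2) := by positivity
    rw [e0, e1] at h
    set M := (N : ℝ) ^ (p - 2)
    set E := η ^ (p - 2)
    have e2 : D * (A + 1) * (d * (1 / (2 * D * (A + 1) * d) * (M * (N : ℝ) ^ 2)) * F +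
        E * M / (p - 1) * J) = M * (N : ℝ) ^ 2 * F / 2 + D * (A + 1) * E * M / (p - 1) * J := by
      field_simp
    rw [e2] at h
    have h2 : M * (N : ℝ) ^ 2 * F / 2 ≤ D * (A + 1) * E * M / (p - 1) * J := by linarith
    have h3 := mul_le_mul_of_nonneg_left h2
      (by positivity : 0 ≤ (p - 1) / (D * (A + 1) * E * M))
    have e3 : (p - 1) / (D * (A + 1) * E * M) * (D * (A + 1) * E * M / (p - 1) * J) = J := by
      field_simp
    have e4 : (p - 1) / (D * (A + 1) * E * M) * (M * (N : ℝ) ^ 2 * F / 2) =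
        (p - 1) / (2 * D * (A + 1) * E) * (N : ℝ) ^ 2 * F := by
      field_simp
    rw [e3, e4] at h3
    exact h3
end

section
/- (Liouville theorem for ancient heat flows; the s = 2 case of the paper's theorem for Λ^s) Let d ≥ 1, 0 < a < d and C > 0. Suppose u : ℝ × ℝ^d → ℝ is smooth on (−∞, 0] × ℝ^d, satisfies the heat equation ∂_t u(t, x) = Δ_x u(t, x) for all t ≤ 0 and x ∈ ℝ^d, and satisfies the decay bound |u(t, x)| ≤ C ‖x‖^{−a} for all t ≤ 0 and all x ∈ ℝ^d with x ≠ 0. Then u(t, x) = 0 for all t ≤ 0 and all x ∈ ℝ^d. -/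
open MeasureTheory

theorem aux_second_deriv (h h' : ℝ → ℝ) (c : ℝ) (hh : ∀ s, HasDerivAt h (h' s) s)
    (hc : HasDerivAt h' c 0) (hm : IsLocalMax h 0) : c ≤ 0 := by
  by_contra hpos
  push Not at hpos
  have e1 : deriv h = h' := funext fun s => (hh s).deriv
  have e0 : deriv h 0 = 0 := hm.deriv_eq_zero
  have hmin : IsLocalMin h 0 :=
    isLocalMin_of_deriv_deriv_pos (by rw [e1, hc.deriv]; exact hpos) e0 (hh 0).continuousAt
  have hconst : h =ᶠ[nhds 0] fun _ => h 0 := by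
    filter_upwards [hm, hmin] with s h1 h2
    exact le_antisymm h1 h2
  have h3 : deriv h =ᶠ[nhds 0] fun _ => 0 := by
    have := hconst.deriv
    simpa using this
  rw [e1] at h3
  have h4 := h3.deriv_eq
  rw [hc.deriv] at h4
  simp at h4
  linarith

theorem aux_line {d : ℕ} (g : (Fin d → ℝ) → ℝ) (hg : ContDiff ℝ (⊤ : ℕ∞) g) (x e : Fin d → ℝ) :
    (∀ s : ℝ, HasDerivAt (fun s : ℝ => g (x + s • e)) (fderiv ℝ g (x + s • e) e) s) ∧
    HasDerivAt (fun s : ℝ => fderiv ℝ g (x + s • e) e) (iteratedFDeriv ℝ 2 g x ![e, e]) 0 := by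
  have hl : ∀ s : ℝ, HasDerivAt (fun s : ℝ => x + s • e) e s := by
    intro s
    have := ((hasDerivAt_id s).smul_const e).const_add x
    simpa using this
  constructor
  · intro s
    have h1 : DifferentiableAt ℝ g (x + s • e) := (hg.differentiable (by simp)) _
    exact h1.hasFDerivAt.comp_hasDerivAt s (hl s)
  · have hg' : ContDiff ℝ 1 (fderiv ℝ g) := hg.fderiv_right (by norm_cast)
    have h1 : DifferentiableAt ℝ (fderiv ℝ g) (x + (0:ℝ) • e) := (hg'.differentiable (by simp)) _
    have h2 := h1.hasFDerivAt.comp_hasDerivAt (0:ℝ) (hl 0)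
    have h3 := h2.clm_apply (hasDerivAt_const (0:ℝ) e)
    rw [iteratedFDeriv_two_apply]
    simpa using h3

/-- unnormalised Gaussian -/
noncomputable def gker (d : ℕ) (σ ρ : ℝ) : ℝ := σ ^ (-(d:ℝ)/2) * Real.exp (-ρ/(4*σ))

theorem gker_pos (d : ℕ) {σ : ℝ} (hσ : 0 < σ) (ρ : ℝ) : 0 < gker d σ ρ := by
  unfold gker; positivity

theorem gker_time (d : ℕ) (σ ρ : ℝ) (hσ : 0 < σ) :
    HasDerivAt (fun σ => gker d σ ρ) ((-d/(2*σ) + ρ/(4*σ^2)) * gker d σ ρ) σ := by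
  unfold gker
  have h1 := Real.hasDerivAt_rpow_const (x := σ) (p := -(d:ℝ)/2) (Or.inl hσ.ne')
  have h2 : HasDerivAt (fun σ : ℝ => -ρ/(4*σ)) (ρ/(4*σ^2)) σ := by
    have := (hasDerivAt_const σ (-ρ)).div ((hasDerivAt_id σ).const_mul 4) (by simpa using hσ.ne')
    refine this.congr_deriv ?_
    simp; field_simp
  refine (h1.mul h2.exp).congr_deriv ?_
  rw [Real.rpow_sub_one hσ.ne']
  field_simp

theorem gker_space1 (d : ℕ) (σ r y s : ℝ) (hσ : 0 < σ) :
    HasDerivAt (fun s => gker d σ (r + 2*s*y + s^2)) (-(y+s)/(2*σ) * gker d σ (r+2*s*y+s^2)) s := by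
  unfold gker
  have h2 : HasDerivAt (fun s : ℝ => -(r+2*s*y+s^2)/(4*σ)) (-(y+s)/(2*σ)) s := by
    have h := (((((hasDerivAt_id s).const_mul 2).mul_const y).const_add r).add
      ((hasDerivAt_id s).pow 2)).neg.div_const (4*σ)
    refine h.congr_deriv ?_
    simp; field_simp; ring
  refine (h2.exp.const_mul (σ ^ (-(d:ℝ)/2))).congr_deriv ?_
  ring

theorem gker_space2 (d : ℕ) (σ r y : ℝ) (hσ : 0 < σ) :
    HasDerivAt (fun s => -(y+s)/(2*σ) * gker d σ (r + 2*s*y + s^2))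
      ((-1/(2*σ) + y^2/(4*σ^2)) * gker d σ r) 0 := by
  have h1 : HasDerivAt (fun s : ℝ => -(y+s)/(2*σ)) (-1/(2*σ)) 0 :=
    ((hasDerivAt_id (0:ℝ)).const_add y).neg.div_const _
  refine (h1.mul (gker_space1 d σ r y 0 hσ)).congr_deriv ?_
  simp
  field_simp
  ring

theorem aux_sumsq {d : ℕ} (x : Fin d → ℝ) (i : Fin d) (s : ℝ) :
    ∑ k, (x + s • (Pi.single i (1:ℝ) : Fin d → ℝ)) k ^ 2 = (∑ k, x k ^ 2) + 2*s*x i + s^2 := by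
  have : ∀ k, (x + s • (Pi.single i (1:ℝ) : Fin d → ℝ)) k ^ 2
      = x k ^ 2 + (if k = i then 2 * s * x k + s^2 else 0) := by
    intro k
    by_cases h : k = i
    · subst h; simp; ring
    · simp [h]
  rw [Finset.sum_congr rfl (fun k _ => this k), Finset.sum_add_distrib]
  simp; ring

theorem aux_compact (d : ℕ) (R : ℝ) : IsCompact {x : Fin d → ℝ | ∑ i, x i ^ 2 ≤ R^2} := by
  refine (isCompact_univ_pi (fun _ : Fin d => isCompact_Icc (a := -|R|) (b := |R|))).of_isClosed_subset
    (isClosed_le (by fun_prop) continuous_const) ?_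
  intro x hx i _
  have h1 : x i ^ 2 ≤ R ^ 2 :=
    (Finset.single_le_sum (f := fun i => x i ^ 2) (fun i _ => sq_nonneg _) (Finset.mem_univ i)).trans hx
  exact abs_le.1 (sq_le_sq.1 h1)

/-- comparison principle on a ball -/
theorem aux_max (d : ℕ) (u : ℝ → (Fin d → ℝ) → ℝ)
    (hsmooth : ContDiffOn ℝ (⊤ : ℕ∞) (fun q : ℝ × (Fin d → ℝ) => u q.1 q.2)
      (Set.Iic (0 : ℝ) ×ˢ Set.univ))
    (heq : ∀ t ≤ (0 : ℝ), ∀ x : Fin d → ℝ,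
      HasDerivWithinAt (fun τ => u τ x) (lapPi (u t) x) (Set.Iic (0 : ℝ)) t)
    (t0 t1 R K : ℝ) (ht : t1 ≤ t0) (ht0 : t0 ≤ 0) (n : ℕ) (c σ : ℕ → ℝ) (hc : ∀ j, 0 < c j)
    (hσ : ∀ j, 0 < σ j)
    (hlat : ∀ t ≤ (0:ℝ), ∀ x : Fin d → ℝ, ∑ i, x i ^ 2 = R^2 → u t x ≤ K)
    (hini : ∀ x : Fin d → ℝ, ∑ i, x i ^ 2 ≤ R^2 →
      u t1 x ≤ K + ∑ j ∈ Finset.range n, c j * gker d (σ j) (∑ i, x i ^ 2))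
    (x0 : Fin d → ℝ) (hx0 : ∑ i, x0 i ^ 2 ≤ R^2) :
    u t0 x0 ≤ K + ∑ j ∈ Finset.range n, c j * gker d (σ j + (t0 - t1)) (∑ i, x0 i ^ 2) := by
  set W : ℝ → (Fin d → ℝ) → ℝ := fun t x =>
    ∑ j ∈ Finset.range n, c j * gker d (σ j + (t - t1)) (∑ i, x i ^ 2) with hW
  have hWnn : ∀ t, t1 ≤ t → ∀ x, 0 ≤ W t x := fun t h x => Finset.sum_nonneg fun j _ =>
    (mul_pos (hc j) (gker_pos d (by linarith [hσ j]) _)).le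
  have key : ∀ δ > 0, u t0 x0 ≤ K + W t0 x0 + δ * (t0 - t1) := by
    intro δ hδ
    set F : ℝ × (Fin d → ℝ) → ℝ := fun q => u q.1 q.2 - W q.1 q.2 - δ * (q.1 - t1) with hF
    set S : Set (ℝ × (Fin d → ℝ)) := Set.Icc t1 t0 ×ˢ {x : Fin d → ℝ | ∑ i, x i ^ 2 ≤ R^2} with hS
    have hScomp : IsCompact S := isCompact_Icc.prod (aux_compact d R)
    have hFc : ContinuousOn F S := by
      refine ((hsmooth.continuousOn.mono ?_).sub ?_).sub (by fun_prop)
      · intro q hq; exact ⟨le_trans hq.1.2 ht0, trivial⟩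
      · refine continuousOn_finsetSum _ fun j _ => continuousOn_const.mul ?_
        unfold gker
        have hp : ∀ q ∈ S, 0 < σ j + (q.1 - t1) := fun q hq => by linarith [hσ j, hq.1.1]
        refine ContinuousOn.mul ?_ ?_
        · exact ContinuousOn.rpow_const (by fun_prop) fun q hq => Or.inl (hp q hq).ne'
        · refine Real.continuous_exp.comp_continuousOn ?_
          refine ContinuousOn.div (by fun_prop) (by fun_prop) fun q hq => ?_
          have := hp q hq
          positivity
    obtain ⟨⟨t, x⟩, hq, hmax⟩ := hScomp.exists_isMaxOn ⟨(t0, x0), ⟨⟨ht, le_rfl⟩, hx0⟩⟩ hFc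
    have hle : F (t0, x0) ≤ F (t, x) := hmax (⟨⟨ht, le_rfl⟩, hx0⟩ : (t0, x0) ∈ S)
    suffices F (t, x) ≤ K by
      simp only [hF] at hle this
      linarith
    by_contra hgt
    push Not at hgt
    have htt : t ∈ Set.Icc t1 t0 := hq.1
    have hxR : ∑ i, x i ^ 2 ≤ R^2 := hq.2
    have ht00 : t ≤ 0 := htt.2.trans ht0
    have hFtx : F (t, x) = u t x - W t x - δ * (t - t1) := rfl
    have hδt : 0 ≤ δ * (t - t1) := mul_nonneg hδ.le (by linarith [htt.1])
    have hxlt : ∑ i, x i ^ 2 < R^2 := by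
      refine lt_of_le_of_ne hxR fun he => ?_
      have := hlat t ht00 x he
      linarith [hWnn t htt.1 x]
    have htlt : t1 < t := by
      refine lt_of_le_of_ne htt.1 fun he => ?_
      have := hini x hxR
      have e : W t x = ∑ j ∈ Finset.range n, c j * gker d (σ j) (∑ i, x i ^ 2) := by
        simp [hW, ← he]
      rw [he] at this
      linarith
    have hσt : ∀ j, 0 < σ j + (t - t1) := fun j => by linarith [hσ j]
    -- second derivatives
    have hut : ContDiff ℝ (⊤ : ℕ∞) (u t) := by
      rw [← contDiffOn_univ]
      exact hsmooth.comp (f := fun x : Fin d → ℝ => (t, x)) (by fun_prop) (fun x _ => ⟨ht00, trivial⟩)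
    set D : Fin d → ℝ := fun i => ∑ j ∈ Finset.range n,
      c j * ((-1/(2*(σ j + (t-t1))) + x i^2/(4*(σ j + (t-t1))^2)) *
        gker d (σ j + (t-t1)) (∑ i, x i ^ 2)) with hD
    have hspace : ∀ i : Fin d,
        iteratedFDeriv ℝ 2 (u t) x ![Pi.single i (1 : ℝ), Pi.single i (1 : ℝ)] - D i ≤ 0 := by
      intro i
      obtain ⟨l1, l2⟩ := aux_line (u t) hut x (Pi.single i (1:ℝ))
      refine aux_second_deriv
        (fun s => u t (x + s • (Pi.single i (1:ℝ) : Fin d → ℝ)) - ∑ j ∈ Finset.range n,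
          c j * gker d (σ j + (t - t1)) ((∑ k, x k ^ 2) + 2*s*x i + s^2)) _ _
        (fun s => (l1 s).sub (HasDerivAt.fun_sum fun j _ =>
          (gker_space1 d _ (∑ k, x k ^ 2) (x i) s (hσt j)).const_mul (c j)))
        (l2.sub (HasDerivAt.fun_sum fun j _ =>
          (gker_space2 d _ (∑ k, x k ^ 2) (x i) (hσt j)).const_mul (c j))) ?_
      have hev : ∀ᶠ s : ℝ in nhds 0, (∑ k, x k ^ 2) + 2*s*x i + s^2 < R^2 := by
        have hcont : Continuous fun s : ℝ => (∑ k, x k ^ 2) + 2*s*x i + s^2 := by fun_prop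
        exact hcont.continuousAt.eventually_lt continuousAt_const (by simpa using hxlt)
      filter_upwards [hev] with s hs
      have hmem : (t, x + s • (Pi.single i (1:ℝ) : Fin d → ℝ)) ∈ S := by
        refine ⟨htt, ?_⟩
        show ∑ k, (x + s • (Pi.single i (1:ℝ) : Fin d → ℝ)) k ^ 2 ≤ R^2
        rw [aux_sumsq]; exact hs.le
      have h5 := hmax hmem
      simp only [hF, hW, Set.mem_ofPred_eq, aux_sumsq] at h5
      simp only [zero_smul, add_zero, mul_zero, zero_mul, ne_eq, OfNat.ofNat_ne_zero,
        not_false_eq_true, zero_pow]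
      linarith
    have hsum : lapPi (u t) x - ∑ i, D i ≤ 0 := by
      unfold lapPi
      rw [← Finset.sum_sub_distrib]
      exact Finset.sum_nonpos fun i _ => hspace i
    -- time derivative
    have hWt : HasDerivAt (fun τ => W τ x) (∑ i, D i) t := by
      have h6 : HasDerivAt (fun τ => W τ x) (∑ j ∈ Finset.range n, c j *
          ((-d/(2*(σ j + (t-t1))) + (∑ i, x i ^ 2)/(4*(σ j + (t-t1))^2)) *
            gker d (σ j + (t-t1)) (∑ i, x i ^ 2))) t := by
        refine HasDerivAt.fun_sum fun j _ => HasDerivAt.const_mul (c j) ?_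
        have h7 : HasDerivAt (fun τ : ℝ => σ j + (τ - t1)) 1 t :=
          ((hasDerivAt_id t).sub_const t1).const_add (σ j)
        have := (gker_time d _ (∑ i, x i ^ 2) (hσt j)).comp t h7
        simpa [Function.comp_def] using this
      convert h6 using 1
      simp only [hD]
      rw [Finset.sum_comm]
      refine Finset.sum_congr rfl fun j _ => ?_
      rw [← Finset.mul_sum, ← Finset.sum_mul, Finset.sum_add_distrib, Finset.sum_const,
        ← Finset.sum_div]
      congr 3
      simp
      ring
    have hFt : HasDerivWithinAt (fun τ => F (τ, x)) (lapPi (u t) x - ∑ i, D i - δ) (Set.Iic t) t := by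
      have h8 := (((heq t ht00 x).mono (Set.Iic_subset_Iic.2 ht00)).sub hWt.hasDerivWithinAt).sub
        ((((hasDerivAt_id t).sub_const t1).const_mul δ).hasDerivWithinAt (s := Set.Iic t))
      refine HasDerivWithinAt.congr_deriv (f := fun τ => F (τ, x)) h8 ?_
      simp
    have hneg : lapPi (u t) x - ∑ i, D i - δ < 0 := by linarith
    have hslope := hasDerivWithinAt_iff_tendsto_slope.1 hFt
    have hd : Set.Iic t \ {t} = Set.Iio t := by ext y; simp [lt_iff_le_and_ne]
    rw [hd] at hslope
    have hev1 := hslope.eventually_lt_const hneg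
    have hev2 : ∀ᶠ y in nhdsWithin t (Set.Iio t), y ∈ Set.Ioo t1 t := Ioo_mem_nhdsLT htlt
    obtain ⟨y, hy1, hy2⟩ := (hev1.and hev2).exists
    have h9 : F (y, x) ≤ F (t, x) := hmax (⟨⟨hy2.1.le, hy2.2.le.trans htt.2⟩, hxR⟩ : (y, x) ∈ S)
    rw [slope_def_field] at hy1
    have : 0 ≤ (F (y, x) - F (t, x)) / (y - t) :=
      div_nonneg_of_nonpos (by linarith) (by linarith [hy2.2])
    linarith
  have hlim : Filter.Tendsto (fun δ : ℝ => K + W t0 x0 + δ * (t0 - t1)) (nhdsWithin 0 (Set.Ioi 0))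
      (nhds (K + W t0 x0)) := by
    have : Continuous fun δ : ℝ => K + W t0 x0 + δ * (t0 - t1) := by fun_prop
    have h := this.tendsto 0
    simp only [zero_mul, add_zero] at h
    exact h.mono_left nhdsWithin_le_nhds
  exact ge_of_tendsto hlim (by filter_upwards [self_mem_nhdsWithin] with δ hδ using key δ hδ)

theorem aux_upper (d : ℕ) (a C : ℝ) (ha0 : 0 < a) (had : a < d) (hC : 0 < C)
    (u : ℝ → (Fin d → ℝ) → ℝ)
    (hsmooth : ContDiffOn ℝ (⊤ : ℕ∞) (fun q : ℝ × (Fin d → ℝ) => u q.1 q.2)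
      (Set.Iic (0 : ℝ) ×ˢ Set.univ))
    (heq : ∀ t ≤ (0 : ℝ), ∀ x : Fin d → ℝ,
      HasDerivWithinAt (fun τ => u τ x) (lapPi (u t) x) (Set.Iic (0 : ℝ)) t)
    (hdecay : ∀ t ≤ (0 : ℝ), ∀ x : Fin d → ℝ, x ≠ 0 →
      u t x ≤ C * (Real.sqrt (∑ i, x i ^ 2)) ^ (-a))
    (t0 : ℝ) (ht0 : t0 ≤ 0) (x0 : Fin d → ℝ) : u t0 x0 ≤ 0 := by
  set q : ℝ := (1/2 : ℝ) ^ ((d:ℝ) - a) with hq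
  have hq0 : 0 < q := by positivity
  have hq1 : q < 1 := Real.rpow_lt_one (by norm_num) (by norm_num) (by linarith)
  set A : ℝ := C * 2 ^ a * Real.exp (1/4) with hA
  have hA0 : 0 < A := by positivity
  have key : ∀ R : ℝ, 0 < R → ∑ i, x0 i ^ 2 ≤ R^2 → u t0 x0 ≤ (C + A * (1-q)⁻¹) * R ^ (-a) := by
    intro R hR hx0
    have ht1 : t0 - R^2 ≤ 0 := by nlinarith [sq_nonneg R]
    obtain ⟨M, hM⟩ := (aux_compact d R).exists_bound_of_continuousOn (f := u (t0 - R^2))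
      (hsmooth.continuousOn.comp (f := fun x : Fin d → ℝ => (t0 - R^2, x)) (by fun_prop)
        (fun x _ => ⟨ht1, trivial⟩))
    have h2a : 1 < (2:ℝ) ^ a := Real.one_lt_rpow (by norm_num) ha0
    obtain ⟨n, hn⟩ := pow_unbounded_of_one_lt (M / (C * 2 ^ a * R ^ (-a))) h2a
    rw [div_lt_iff₀ (by positivity)] at hn
    set ρ : ℕ → ℝ := fun j => R * (1/2)^j with hρ
    have hρ0 : ∀ j, 0 < ρ j := fun j => by positivity
    have hρa : ∀ j, (ρ j) ^ (-a) = R ^ (-a) * (2 ^ a) ^ j := by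
      intro j
      simp only [hρ]
      rw [Real.mul_rpow hR.le (by positivity)]
      congr 1
      rw [← Real.rpow_natCast, ← Real.rpow_natCast, ← Real.rpow_mul (by norm_num), ← Real.rpow_mul (by norm_num),
        one_div, Real.inv_rpow (by norm_num), ← Real.rpow_neg (by norm_num)]
      congr 1; ring
    set c : ℕ → ℝ := fun j => A * (ρ j) ^ ((d:ℝ) - a) with hc
    have hc0 : ∀ j, 0 < c j := fun j => mul_pos hA0 (Real.rpow_pos_of_pos (hρ0 j) _)
    have hsq : ∀ y : ℝ, 0 < y → (y^2) ^ (-(d:ℝ)/2) = y ^ (-(d:ℝ)) := by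
      intro y hy
      rw [← Real.rpow_natCast, ← Real.rpow_mul hy.le]
      congr 1; push_cast; ring
    -- lower bound on each bump at the initial time
    have hbump : ∀ j, ∀ r : ℝ, r ≤ ρ j ^ 2 → C * 2 ^ a * ρ j ^ (-a) ≤ c j * gker d (ρ j ^ 2) r := by
      intro j r hr
      simp only [hc, hA, gker]
      rw [hsq _ (hρ0 j)]
      have e1 : ρ j ^ ((d:ℝ) - a) * ρ j ^ (-(d:ℝ)) = ρ j ^ (-a) := by
        rw [← Real.rpow_add (hρ0 j)]; congr 1; ring
      have e2 : 1 ≤ Real.exp (1/4) * Real.exp (-r / (4 * ρ j ^ 2)) := by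
        rw [← Real.exp_add]
        apply Real.one_le_exp
        have : r / (4 * ρ j ^ 2) ≤ 1/4 := by
          rw [div_le_iff₀ (by have := hρ0 j; positivity)]; linarith
        rw [neg_div]; linarith
      calc C * 2 ^ a * ρ j ^ (-a) ≤ C * 2 ^ a * ρ j ^ (-a) * (Real.exp (1/4) * Real.exp (-r / (4 * ρ j ^ 2))) := by
            apply le_mul_of_one_le_right _ e2
            have := hρ0 j
            positivity
        _ = _ := by rw [← e1]; ring
    have hsingle : ∀ r : ℝ, ∀ j ≤ n, c j * gker d (ρ j ^ 2) r ≤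
        ∑ j ∈ Finset.range (n+1), c j * gker d (ρ j ^ 2) r := by
      intro r j hj
      exact Finset.single_le_sum (f := fun j => c j * gker d (ρ j ^ 2) r)
        (fun j _ => (mul_pos (hc0 j) (gker_pos d (by have := hρ0 j; positivity) r)).le)
        (Finset.mem_range.2 (by omega))
    have hmain := aux_max d u hsmooth heq t0 (t0 - R^2) R (C * R ^ (-a)) (by nlinarith [sq_nonneg R]) ht0
      (n+1) c (fun j => ρ j ^ 2) hc0 (fun j => by have := hρ0 j; positivity)
      (by
        intro t ht x hx
        have hx0 : x ≠ 0 := by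
          rintro rfl
          simp at hx
          have := pow_pos hR 2
          linarith
        have := hdecay t ht x hx0
        rwa [hx, Real.sqrt_sq hR.le] at this)
      (by
        intro x hx
        have hKnn : 0 ≤ C * R ^ (-a) := by positivity
        have hsmall : ∑ i, x i ^ 2 ≤ ρ n ^ 2 → u (t0 - R^2) x ≤ C * R ^ (-a) +
            ∑ j ∈ Finset.range (n+1), c j * gker d (ρ j ^ 2) (∑ i, x i ^ 2) := by
          intro hr
          have h1 := hbump n _ hr
          have h2 := hsingle (∑ i, x i ^ 2) n le_rfl
          have h3 := (le_abs_self _).trans (hM x hx)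
          rw [hρa] at h1
          nlinarith
        by_cases hz : x = 0
        · apply hsmall
          subst hz
          simp
          positivity
        have hrpos : 0 < ∑ i, x i ^ 2 := by
          obtain ⟨i, hi⟩ := Function.ne_iff.1 hz
          exact Finset.sum_pos' (fun i _ => sq_nonneg _) ⟨i, Finset.mem_univ i, by
            have : x i ≠ 0 := hi
            positivity⟩
        set r := Real.sqrt (∑ i, x i ^ 2) with hr
        have hr0 : 0 < r := Real.sqrt_pos.2 hrpos
        have hrr : r^2 = ∑ i, x i ^ 2 := Real.sq_sqrt hrpos.le
        have hrR : r ≤ R := by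
          apply Real.sqrt_le_iff.2 ⟨hR.le, hx⟩
        obtain ⟨j, hj1, hj2⟩ := exists_nat_pow_near_of_lt_one (x := r / R) (y := (1/2:ℝ))
          (by positivity) ((div_le_one hR).2 hrR) (by norm_num) (by norm_num)
        have hj3 : r ≤ ρ j := by
          rw [div_le_iff₀ hR] at hj2; simp only [hρ]; linarith
        have hj4 : ρ j * (1/2) ≤ r := by
          rw [lt_div_iff₀ hR, pow_succ] at hj1; simp only [hρ]; linarith
        by_cases hjn : j ≤ n
        · have h1 := hbump j (∑ i, x i ^ 2) (by rw [← hrr]; gcongr)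
          have h2 := hsingle (∑ i, x i ^ 2) j hjn
          have h3 := hdecay _ ht1 x hz
          have h4 : r ^ (-a) ≤ 2 ^ a * ρ j ^ (-a) := by
            have h5 : r ^ (-a) ≤ (ρ j * (1/2)) ^ (-a) :=
              Real.rpow_le_rpow_of_nonpos (by have := hρ0 j; positivity) hj4 (by linarith)
            rw [Real.mul_rpow (hρ0 j).le (by norm_num)] at h5
            have h6 : ((1:ℝ)/2) ^ (-a) = 2 ^ a := by
              rw [one_div, Real.inv_rpow (by norm_num), Real.rpow_neg (by norm_num), inv_inv]
            rw [h6] at h5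
            linarith
          rw [← hr] at h3
          have h7 := mul_le_mul_of_nonneg_left h4 hC.le
          linarith
        · apply hsmall
          rw [← hrr]
          have : ρ j ≤ ρ n := by
            simp only [hρ]
            apply mul_le_mul_of_nonneg_left _ hR.le
            exact pow_le_pow_of_le_one (by norm_num) (by norm_num) (by omega)
          have : r ≤ ρ n := hj3.trans this
          gcongr)
      x0 hx0
    have hfin : ∀ j, c j * gker d (ρ j ^ 2 + (t0 - (t0 - R^2))) (∑ i, x0 i ^ 2) ≤ A * R ^ (-a) * q ^ j := by
      intro j
      have e0 : t0 - (t0 - R^2) = R^2 := by ring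
      rw [e0]
      have g1 : gker d (ρ j ^ 2 + R^2) (∑ i, x0 i ^ 2) ≤ R ^ (-(d:ℝ)) := by
        unfold gker
        rw [← hsq R hR]
        have hs : 0 ≤ ∑ i, x0 i ^ 2 := Finset.sum_nonneg fun i _ => sq_nonneg _
        have g2 : (ρ j ^ 2 + R^2) ^ (-(d:ℝ)/2) ≤ (R^2) ^ (-(d:ℝ)/2) :=
          Real.rpow_le_rpow_of_nonpos (by positivity) (by nlinarith [sq_nonneg (ρ j)])
            (by have : (0:ℝ) ≤ d := Nat.cast_nonneg d
                linarith)
        have g3 : Real.exp (-(∑ i, x0 i ^ 2) / (4 * (ρ j ^ 2 + R^2))) ≤ 1 := by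
          apply Real.exp_le_one_iff.2
          exact div_nonpos_of_nonpos_of_nonneg (by linarith) (by positivity)
        calc _ ≤ (R^2) ^ (-(d:ℝ)/2) * 1 := by gcongr
          _ = _ := mul_one _
      refine (mul_le_mul_of_nonneg_left g1 (hc0 j).le).trans (le_of_eq ?_)
      simp only [hc, hρ, hq]
      rw [Real.mul_rpow hR.le (by positivity)]
      have e1 : R ^ ((d:ℝ) - a) * R ^ (-(d:ℝ)) = R ^ (-a) := by
        rw [← Real.rpow_add hR]; congr 1; ring
      have e2 : (((1:ℝ)/2) ^ j) ^ ((d:ℝ) - a) = (((1:ℝ)/2) ^ ((d:ℝ) - a)) ^ j := by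
        rw [← Real.rpow_natCast, ← Real.rpow_natCast, ← Real.rpow_mul (by norm_num),
          ← Real.rpow_mul (by norm_num), mul_comm]
      rw [e2, ← e1]; ring
    have hgeom : ∑ j ∈ Finset.range (n+1), q ^ j ≤ (1-q)⁻¹ := by
      rw [← tsum_geometric_of_lt_one hq0.le hq1]
      exact (summable_geometric_of_lt_one hq0.le hq1).sum_le_tsum _ (fun j _ => by positivity)
    calc u t0 x0 ≤ _ := hmain
      _ ≤ C * R ^ (-a) + ∑ j ∈ Finset.range (n+1), A * R ^ (-a) * q ^ j := by
          exact add_le_add le_rfl (Finset.sum_le_sum fun j _ => hfin j)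
      _ = C * R ^ (-a) + A * R ^ (-a) * ∑ j ∈ Finset.range (n+1), q ^ j := by rw [Finset.mul_sum]
      _ ≤ C * R ^ (-a) + A * R ^ (-a) * (1-q)⁻¹ := by gcongr
      _ = _ := by ring
  have hlim : Filter.Tendsto (fun R : ℝ => (C + A * (1-q)⁻¹) * R ^ (-a)) Filter.atTop (nhds 0) := by
    simpa using (tendsto_rpow_neg_atTop ha0).const_mul (C + A * (1-q)⁻¹)
  refine ge_of_tendsto hlim ?_
  filter_upwards [Filter.eventually_gt_atTop 0,
    Filter.eventually_ge_atTop (Real.sqrt (∑ i, x0 i ^ 2))] with R h1 h2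
  exact key R h1 ((Real.sqrt_le_left h1.le).1 h2)

theorem stmt_19 (d : ℕ) (hd : 1 ≤ d) (a C : ℝ) (ha0 : 0 < a) (had : a < d) (hC : 0 < C)
    (u : ℝ → (Fin d → ℝ) → ℝ)
    (hsmooth : ContDiffOn ℝ (⊤ : ℕ∞) (fun q : ℝ × (Fin d → ℝ) => u q.1 q.2)
      (Set.Iic (0 : ℝ) ×ˢ Set.univ))
    (heq : ∀ t ≤ (0 : ℝ), ∀ x : Fin d → ℝ,
      HasDerivWithinAt (fun τ => u τ x) (lapPi (u t) x) (Set.Iic (0 : ℝ)) t)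
    (hdecay : ∀ t ≤ (0 : ℝ), ∀ x : Fin d → ℝ, x ≠ 0 →
      |u t x| ≤ C * (Real.sqrt (∑ i, x i ^ 2)) ^ (-a)) :
    ∀ t ≤ (0 : ℝ), ∀ x : Fin d → ℝ, u t x = 0 := by
  intro t ht x
  apply le_antisymm
  · exact aux_upper d a C ha0 had hC u hsmooth heq
      (fun t ht x hx => (le_abs_self _).trans (hdecay t ht x hx)) t ht x
  · have h := aux_upper d a C ha0 had hC (fun t x => - u t x) hsmooth.neg
      (fun t ht x => by
        have e : lapPi (fun x => - u t x) x = - lapPi (u t) x := by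
          unfold lapPi
          rw [← Finset.sum_neg_distrib]
          refine Finset.sum_congr rfl fun i _ => ?_
          have : (fun x => - u t x) = - u t := rfl
          rw [this, iteratedFDeriv_neg_apply]
          simp
        rw [e]
        exact (heq t ht x).neg)
      (fun t ht x hx => (neg_le_abs _).trans (hdecay t ht x hx)) t ht x
    simpa using h
end
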